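/- arXiv:2312.11077 — 3 statements merged into one kernel-verified Lean document; each statement's English description precedes it below -/
import Mathlib

section
/- Let (R, 𝔪) be a two-dimensional regular local ring with infinite residue field, let I be an 𝔪-primary ideal with ord(I) = m and μ(I) = n+1, and let 2 ≤ r ≤ m. Then, up to isomorphism of R-modules, the module M_r(I) does not depend on the chosen minimal generating set a_1, …, a_{n+1} of I, nor on the chosen regular system of parameters x, y generating 𝔪, nor on the choice of coefficients expressing each generator a_j in terms of x^{r-1}, x^{r-2}y, …, y^{r-1}. -/
open IsLocalRing

section Defs

variable {R : Type*} [CommRing R]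

/-- `R` is a two-dimensional regular local ring: Noetherian local of Krull dimension 2
whose maximal ideal is generated by two elements. -/
def IsTwoDimRegularLocal (R : Type*) [CommRing R] [IsLocalRing R] : Prop :=
  IsNoetherianRing R ∧ ringKrullDim R = 2 ∧
    ∃ x y : R, maximalIdeal R = Ideal.span {x, y}

/-- `z` lies in the integral closure of the ideal `I`, i.e. it satisfies an equation
`z ^ n + c 1 * z ^ (n-1) + ⋯ + c n = 0` with `c i ∈ I ^ i`. -/
def MemIntClosure (I : Ideal R) (z : R) : Prop :=
  ∃ n : ℕ, 0 < n ∧ ∃ c : ℕ → R, (∀ i ∈ Finset.Icc 1 n, c i ∈ I ^ i) ∧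
    z ^ n + ∑ i ∈ Finset.Icc 1 n, c i * z ^ (n - i) = 0

/-- The ideal `I` is integrally closed. -/
def IdealIntClosed (I : Ideal R) : Prop := ∀ z, MemIntClosure I z → z ∈ I

/-- `I` is `𝔪`-primary. -/
def IsMPrimary [IsLocalRing R] (I : Ideal R) : Prop := I.radical = maximalIdeal R

/-- `ord I = n` : `n` is the largest power of the maximal ideal containing `I`. -/
def ordEQ [IsLocalRing R] (I : Ideal R) (n : ℕ) : Prop :=
  I ≤ maximalIdeal R ^ n ∧ ¬ I ≤ maximalIdeal R ^ (n + 1)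

/-- Determinant of the square matrix with columns `w 0, …, w (r-1)`. -/
def colDet {r : ℕ} (w : Fin r → Fin r → R) : R :=
  Matrix.det (Matrix.of fun i j => w j i)

/-- The ideal of maximal minors `I(M)` of a submodule `M ⊆ R^r`:  it is generated by all
determinants of `r × r` matrices whose columns lie in `M`. -/
def maxMinors {r : ℕ} (M : Submodule R (Fin r → R)) : Ideal R :=
  Ideal.span { d | ∃ w : Fin r → Fin r → R, (∀ j, w j ∈ M) ∧ d = colDet w }

/-- The ideal `I_k(M)` of `k × k` minors of a matrix whose columns generate `M ⊆ R^r`. -/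
def minorsIdeal (k : ℕ) {r : ℕ} (M : Submodule R (Fin r → R)) : Ideal R :=
  Ideal.span { d | ∃ (w : Fin k → Fin r → R) (ρ : Fin k → Fin r),
    Function.Injective ρ ∧ (∀ j, w j ∈ M) ∧
    d = Matrix.det (Matrix.of fun i j : Fin k => w j (ρ i)) }

/-- `v ∈ R^r` is integral over the submodule `M ⊆ R^r` : the determinant of every square
matrix with one column `v` and the remaining columns in `M` is integral over `I(M)`. -/
def IntegralOverMod {r : ℕ} (M : Submodule R (Fin r → R)) (v : Fin r → R) : Prop :=
  ∀ (w : Fin r → Fin r → R) (j₀ : Fin r), w j₀ = v → (∀ j, j ≠ j₀ → w j ∈ M) →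
    MemIntClosure (maxMinors M) (colDet w)

/-- The submodule `M ⊆ R^r` is integrally closed. -/
def ModIntClosed {r : ℕ} (M : Submodule R (Fin r → R)) : Prop :=
  ∀ v, IntegralOverMod M v → v ∈ M

/-- The length of an `R`-module, as the Krull dimension of its submodule lattice. -/
noncomputable def modLength (R : Type*) (M : Type*) [CommRing R] [AddCommGroup M]
    [Module R M] : WithBot ℕ∞ :=
  Order.krullDim (Submodule R M)

/-- `M ⊆ R^r` has finite colength; equivalently, `M` is a finitely generated torsion-free
module of rank `r` with double dual `M** = R^r`. -/
def FinColength {r : ℕ} (M : Submodule R (Fin r → R)) : Prop :=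
  IsFiniteLength R ((Fin r → R) ⧸ M)

/-- `M` has a nonzero free direct summand. -/
def HasFreeSummand {r : ℕ} (M : Submodule R (Fin r → R)) : Prop :=
  ∃ N P : Submodule R (Fin r → R), N ⊔ P = M ∧ N ⊓ P = ⊥ ∧ N ≠ ⊥ ∧ Module.Free R ↥N

/-- `M` is a direct sum of two nonzero submodules. -/
def DecomposableSub {r : ℕ} (M : Submodule R (Fin r → R)) : Prop :=
  ∃ N P : Submodule R (Fin r → R), N ⊔ P = M ∧ N ⊓ P = ⊥ ∧ N ≠ ⊥ ∧ P ≠ ⊥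

/-- `M` is nonzero and not a direct sum of two nonzero submodules. -/
def IndecomposableSub {r : ℕ} (M : Submodule R (Fin r → R)) : Prop :=
  M ≠ ⊥ ∧ ¬ DecomposableSub M

/-- `a` is a minimal generating set of the ideal `I`. -/
def MinGens {m : ℕ} (I : Ideal R) (a : Fin m → R) : Prop :=
  Ideal.span (Set.range a) = I ∧ ∀ j : Fin m, Ideal.span (a '' {j}ᶜ) ≠ I

/-- `a = c 0 * x^(r-1) + c 1 * x^(r-2) * y + ⋯ + c (r-1) * y^(r-1)`. -/
def Expresses (r : ℕ) (x y : R) (c : Fin r → R) (a : R) : Prop :=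
  a = ∑ i : Fin r, c i * x ^ (r - 1 - (i : ℕ)) * y ^ (i : ℕ)

/-- The `k`-th Koszul relation column between `x^(r-1), …, y^(r-1)`:
`y` in position `k` and `-x` in position `k+1`. -/
def stdRelCol (r : ℕ) (x y : R) (k : ℕ) : Fin r → R :=
  fun i => if (i : ℕ) = k then y else if (i : ℕ) = k + 1 then -x else 0

/-- The module generated by the coefficient columns `C j` together with the `r - 1`
Koszul relation columns between `x^(r-1), …, y^(r-1)`. -/
def MrSpan (r : ℕ) (x y : R) {m : ℕ} (C : Fin m → Fin r → R) :
    Submodule R (Fin r → R) :=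
  Submodule.span R (Set.range C ∪ { v | ∃ k, k < r - 1 ∧ v = stdRelCol r x y k })

/-- The data `(x, y, a, C)` presents the module `M_r(I)` : `𝔪 = (x,y)`, `a` is a minimal
generating set of `I` and column `C j` expresses `a j` in terms of `x^(r-1), …, y^(r-1)`. -/
def IsMrPresentation [IsLocalRing R] (r : ℕ) (I : Ideal R) {m : ℕ} (x y : R)
    (a : Fin m → R) (C : Fin m → Fin r → R) : Prop :=
  maximalIdeal R = Ideal.span {x, y} ∧ MinGens I a ∧ ∀ j, Expresses r x y (C j) (a j)

/-- `N` is a reduction of `M` : `N ≤ M` and every element of `M` is integral over `N`. -/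
def IsReductionMod {r : ℕ} (N M : Submodule R (Fin r → R)) : Prop :=
  N ≤ M ∧ ∀ v ∈ M, IntegralOverMod N v

/-- `N` is a minimal reduction of `M`. -/
def IsMinimalReductionMod {r : ℕ} (N M : Submodule R (Fin r → R)) : Prop :=
  IsReductionMod N M ∧ ∀ N' ≤ N, IsReductionMod N' M → N' = N

/-- The `j`-th signed maximal minor of an `r × (r+1)` matrix. -/
def signedMinor {r : ℕ} (A : Matrix (Fin r) (Fin (r + 1)) R) (j : Fin (r + 1)) : R :=
  (-1 : R) ^ (j : ℕ) * (A.submatrix id j.succAbove).det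

/-- `M ⊆ R^r` is extremal: integrally closed, without free direct summands, with
`λ(R/I(M)) = λ(R^r/M) + r(r-1)/2`. -/
def IsExtremal {r : ℕ} (M : Submodule R (Fin r → R)) : Prop :=
  FinColength M ∧ ModIntClosed M ∧ ¬ HasFreeSummand M ∧
    modLength R (R ⧸ maxMinors M) =
      modLength R ((Fin r → R) ⧸ M) + ((r * (r - 1) / 2 : ℕ) : WithBot ℕ∞)

/-- `a ∈ J`, `b ∈ K` is a joint reduction of the pair `(J, K)`. -/
def IsJointReduction (J K : Ideal R) (a b : R) : Prop :=
  a ∈ J ∧ b ∈ K ∧ ∃ n : ℕ,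
    (Ideal.span {a} * K + Ideal.span {b} * J) * (J * K) ^ n = (J * K) ^ (n + 1)

/-- `S` is the matrix `Sym^k(Q)` for `Q = [[a, c], [b, d]]` : with `X = aU + bV`,
`Y = cU + dV`, the `j`-th column of `S` records the coefficients of
`X^(k-j) Y^j` in terms of `U^k, U^(k-1)V, …, V^k`. -/
def IsSymOf (k : ℕ) (a b c d : R) (S : Matrix (Fin (k + 1)) (Fin (k + 1)) R) : Prop :=
  ∀ j : Fin (k + 1),
    ((MvPolynomial.C a * MvPolynomial.X 0 + MvPolynomial.C b * MvPolynomial.X 1) ^ (k - (j : ℕ)) *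
        (MvPolynomial.C c * MvPolynomial.X 0 + MvPolynomial.C d * MvPolynomial.X 1) ^ (j : ℕ)
      : MvPolynomial (Fin 2) R)
    = ∑ i : Fin (k + 1), MvPolynomial.C (S i j) *
        MvPolynomial.X 0 ^ (k - (i : ℕ)) * MvPolynomial.X 1 ^ (i : ℕ)

/-- The `r × s` bidiagonal matrix with `y` on the diagonal and `-x` directly below it. -/
def bidiag (r s : ℕ) (x y : R) : Matrix (Fin r) (Fin s) R :=
  Matrix.of fun i j =>
    if (i : ℕ) = (j : ℕ) then y else if (i : ℕ) = (j : ℕ) + 1 then -x else 0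

end Defs

section RegularParameters

variable {R : Type*} [CommRing R] [IsLocalRing R] {x y : R}

lemma pow_notMem_span_singleton_of_maximalIdeal_eq [IsNoetherianRing R]
    (hdim : ringKrullDim R = 2) (hxy : maximalIdeal R = Ideal.span {x, y}) (n : ℕ) :
    y ^ n ∉ Ideal.span {x} := by
  intro hy
  have hmin : maximalIdeal R ∈ (Ideal.span {x}).minimalPrimes := by
    refine ⟨⟨inferInstance, ?_⟩, fun q hq _ => ?_⟩
    · rw [hxy]
      exact Ideal.span_mono (by simp)
    · have := hq.1
      rw [hxy, Ideal.span_le, Set.insert_subset_iff, Set.singleton_subset_iff]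
      exact ⟨hq.2 (Ideal.mem_span_singleton_self x), this.mem_of_pow_mem n (hq.2 hy)⟩
  have h1 := Ideal.height_le_one_of_isPrincipal_of_mem_minimalPrimes _ _ hmin
  have h2 := maximalIdeal_height_eq_ringKrullDim (R := R)
  rw [hdim] at h2
  have h3 : (maximalIdeal R).height = 2 := WithBot.coe_injective h2
  rw [h3] at h1
  exact absurd h1 (by decide)

lemma exists_eq_mul_add_unit_mul_pow [IsNoetherianRing R]
    (hxy : maximalIdeal R = Ideal.span {x, y}) {a : R} (ha : a ∉ Ideal.span {x}) :
    ∃ (n : ℕ) (s w : R), IsUnit w ∧ a = x * s + w * y ^ n := by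
  have hx : x ∈ maximalIdeal R := hxy ▸ Ideal.subset_span (by simp)
  by_contra! hne
  have key : ∀ n, ∃ s t, a = x * s + t * y ^ n := by
    intro n
    induction n with
    | zero => exact ⟨0, a, by simp⟩
    | succ n ih =>
      obtain ⟨s, t, hst⟩ := ih
      have ht : t ∈ maximalIdeal R := by
        rw [mem_maximalIdeal, mem_nonunits_iff]
        exact fun hu => hne n s t hu hst
      rw [hxy, Ideal.mem_span_pair] at ht
      obtain ⟨p, q, rfl⟩ := ht
      exact ⟨s + p * y ^ n, q, by rw [hst]; ring⟩
  have hnt : Nontrivial (R ⧸ Ideal.span {x}) := by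
    refine Ideal.Quotient.nontrivial_iff.mpr fun h => ?_
    exact (maximalIdeal.isMaximal R).ne_top
      (top_le_iff.mp (h ▸ (Ideal.span_singleton_le_iff_mem _).mpr hx))
  have : IsLocalRing (R ⧸ Ideal.span {x}) :=
    IsLocalRing.of_surjective' _ Ideal.Quotient.mk_surjective
  have hy : Ideal.Quotient.mk (Ideal.span {x}) y ∈ maximalIdeal _ := by
    have : IsLocalHom (Ideal.Quotient.mk (Ideal.span {x})) :=
      IsLocalHom.of_surjective _ Ideal.Quotient.mk_surjective
    rw [mem_maximalIdeal, map_mem_nonunits_iff, ← mem_maximalIdeal, hxy]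
    exact Ideal.subset_span (by simp)
  have hmem : Ideal.Quotient.mk (Ideal.span {x}) a ∈
      (⨅ i : ℕ, maximalIdeal (R ⧸ Ideal.span {x}) ^ i) := by
    refine (Submodule.mem_iInf _).mpr fun n => ?_
    obtain ⟨s, t, hst⟩ := key n
    have hx0 : Ideal.Quotient.mk (Ideal.span {x}) x = 0 :=
      Ideal.Quotient.eq_zero_iff_mem.mpr (Ideal.mem_span_singleton_self x)
    rw [hst, map_add, map_mul, hx0, zero_mul, zero_add, map_mul, map_pow]
    exact Ideal.mul_mem_left _ _ (Ideal.pow_mem_pow hy n)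
  rw [Ideal.iInf_pow_eq_bot_of_isLocalRing _ (maximalIdeal.isMaximal _).ne_top] at hmem
  exact ha (Ideal.Quotient.eq_zero_iff_mem.mp hmem)

lemma isPrime_span_singleton_of_maximalIdeal_eq [IsNoetherianRing R]
    (hdim : ringKrullDim R = 2) (hxy : maximalIdeal R = Ideal.span {x, y}) :
    (Ideal.span {x}).IsPrime := by
  refine Ideal.isPrime_iff.mpr ⟨fun h => ?_, fun {a b} hab => ?_⟩
  · exact pow_notMem_span_singleton_of_maximalIdeal_eq hdim hxy 0 (h ▸ Submodule.mem_top)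
  · by_contra! hne
    obtain ⟨n, s, w, hw, rfl⟩ := exists_eq_mul_add_unit_mul_pow hxy hne.1
    obtain ⟨k, t, z, hz, rfl⟩ := exists_eq_mul_add_unit_mul_pow hxy hne.2
    refine pow_notMem_span_singleton_of_maximalIdeal_eq hdim hxy (n + k) ?_
    rw [← Ideal.unit_mul_mem_iff_mem _ (hw.mul hz)]
    rw [Ideal.mem_span_singleton] at hab ⊢
    obtain ⟨e, he⟩ := hab
    exact ⟨e - (s * (x * t + z * y ^ k) + w * y ^ n * t), by linear_combination he⟩

lemma isDomain_of_maximalIdeal_eq [IsNoetherianRing R]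
    (hdim : ringKrullDim R = 2) (hxy : maximalIdeal R = Ideal.span {x, y}) : IsDomain R := by
  have hgen : ∀ k, maximalIdeal R = Ideal.span {x + y ^ (k + 1), y} := fun k => by
    rw [hxy, pow_succ, Ideal.span_pair_add_mul_right]
  obtain ⟨k, hk⟩ : ∃ k, ∀ P ∈ minimalPrimes R, x + y ^ (k + 1) ∉ P := by
    by_contra! h
    choose P hP hxP using h
    have := (minimalPrimes.finite_of_isNoetherianRing R).to_subtype
    obtain ⟨i, j, hij, hPij⟩ := Finite.exists_ne_map_eq_of_infinite
      (fun k => (⟨P k, hP k⟩ : minimalPrimes R))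
    wlog hlt : i < j generalizing i j
    · exact this j i hij.symm hPij.symm (by omega)
    have hPp := Ideal.IsMinimalPrime.isPrime (hP i)
    have hle := le_maximalIdeal hPp.ne_top
    simp only [Subtype.mk.injEq] at hPij
    have hj := hxP j
    rw [← hPij] at hj
    have hsub := (P i).sub_mem (hxP i) hj
    obtain ⟨d, rfl⟩ := Nat.exists_eq_add_of_lt hlt
    have hfac : x + y ^ (i + 1) - (x + y ^ (i + d + 1 + 1)) = y ^ (i + 1) * (1 - y ^ (d + 1)) := by
      ring
    have hym : y ∈ maximalIdeal R := hxy ▸ Ideal.subset_span (by simp)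
    have hy : y ∈ P i := by
      rw [hfac] at hsub
      rcases hPp.mem_or_mem hsub with h | h
      · exact hPp.mem_of_pow_mem _ h
      · exfalso
        have h1 := (maximalIdeal R).add_mem (hle h) (Ideal.pow_mem_of_mem _ hym (d + 1) (by omega))
        rw [sub_add_cancel] at h1
        exact (maximalIdeal.isMaximal R).ne_top ((Ideal.eq_top_iff_one _).mpr h1)
    have hPm : P i = maximalIdeal R := by
      refine le_antisymm hle ?_
      rw [hgen i, Ideal.span_le, Set.insert_subset_iff, Set.singleton_subset_iff]
      exact ⟨hxP i, hy⟩
    have hmin := hP i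
    rw [hPm] at hmin
    have hx := isPrime_span_singleton_of_maximalIdeal_eq hdim hxy
    have := hmin.2 ⟨hx, bot_le⟩ (le_maximalIdeal hx.ne_top) hym
    exact pow_notMem_span_singleton_of_maximalIdeal_eq hdim hxy 1 (by simpa using this)
  have hQ := isPrime_span_singleton_of_maximalIdeal_eq hdim (hgen k)
  set z := x + y ^ (k + 1)
  obtain ⟨P, hP, hPQ⟩ := Ideal.exists_minimalPrimes_le (bot_le (a := Ideal.span {z}))
  have hPp := Ideal.IsMinimalPrime.isPrime hP
  have hzP : z ∉ P := hk P hP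
  have hzm : z ∈ maximalIdeal R := hgen k ▸ Ideal.subset_span (Set.mem_insert _ _)
  have hbot : P = ⊥ := by
    refine Submodule.eq_bot_of_le_smul_of_le_jacobson_bot (maximalIdeal R) P
      (IsNoetherian.noetherian P) (fun p hp => ?_) (maximalIdeal_le_jacobson _)
    obtain ⟨q, rfl⟩ := Ideal.mem_span_singleton.mp (hPQ hp)
    exact Submodule.smul_mem_smul hzm ((hPp.mem_or_mem hp).resolve_left hzP)
  exact @IsDomain.of_bot_isPrime R _ (hbot ▸ hPp)

end RegularParameters

section MonomialMap

variable {R : Type*} [CommRing R]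

/-- The map `R^r → R` sending `c` to `c 0 * x^(r-1) + ⋯ + c (r-1) * y^(r-1)`. -/
noncomputable def monomialMap (r : ℕ) (x y : R) : (Fin r → R) →ₗ[R] R :=
  Fintype.linearCombination R fun i : Fin r => x ^ (r - 1 - (i : ℕ)) * y ^ (i : ℕ)

lemma monomialMap_apply (r : ℕ) (x y : R) (c : Fin r → R) :
    monomialMap r x y c = ∑ i : Fin r, c i * x ^ (r - 1 - (i : ℕ)) * y ^ (i : ℕ) := by
  simp [monomialMap, Fintype.linearCombination_apply, mul_assoc]

lemma expresses_iff {r : ℕ} {x y : R} {c : Fin r → R} {a : R} :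
    Expresses r x y c a ↔ monomialMap r x y c = a := by
  rw [monomialMap_apply, Expresses, eq_comm]

lemma monomialMap_succ (k : ℕ) (x y : R) (c : Fin (k + 2) → R) :
    monomialMap (k + 2) x y c =
      x * monomialMap (k + 1) x y (fun i => c i.castSucc) + c (Fin.last _) * y ^ (k + 1) := by
  rw [monomialMap_apply, monomialMap_apply, Fin.sum_univ_castSucc, Finset.mul_sum]
  congr 1
  · refine Finset.sum_congr rfl fun i _ => ?_
    have h : k + 2 - 1 - (i.castSucc : ℕ) = k + 1 - 1 - (i : ℕ) + 1 := by
      simp only [Fin.val_castSucc]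
      omega
    rw [h, pow_succ, Fin.val_castSucc]
    ring
  · simp

lemma stdRelCol_eq_single {r : ℕ} (x y : R) {k : ℕ} (hk : k < r - 1) :
    stdRelCol r x y k =
      Pi.single ⟨k, by omega⟩ y - Pi.single ⟨k + 1, by omega⟩ x := by
  ext i
  simp only [stdRelCol, Pi.sub_apply, Pi.single_apply, Fin.ext_iff]
  split_ifs <;> first | omega | simp

lemma monomialMap_stdRelCol {r : ℕ} (x y : R) {k : ℕ} (hk : k < r - 1) :
    monomialMap r x y (stdRelCol r x y k) = 0 := by
  have h : r - 1 - k = r - 1 - (k + 1) + 1 := by omega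
  rw [stdRelCol_eq_single x y hk, map_sub, monomialMap,
    Fintype.linearCombination_apply_single, Fintype.linearCombination_apply_single]
  simp only [smul_eq_mul, h]
  ring

/-- Extension of a vector by a zero in the last position. -/
def snocZero (R : Type*) [CommRing R] (n : ℕ) : (Fin n → R) →ₗ[R] (Fin (n + 1) → R) where
  toFun c := Fin.snoc (α := fun _ => R) c 0
  map_add' c d := by
    ext i
    refine Fin.lastCases ?_ (fun i => ?_) i <;> simp
  map_smul' t c := by
    ext i
    refine Fin.lastCases ?_ (fun i => ?_) i <;> simp

lemma snocZero_stdRelCol (x y : R) {n k : ℕ} (hk : k < n - 1) :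
    snocZero R n (stdRelCol n x y k) = stdRelCol (n + 1) x y k := by
  ext i
  refine Fin.lastCases ?_ (fun i => ?_) i
  · simp only [snocZero, LinearMap.coe_mk, AddHom.coe_mk, Fin.snoc_last, stdRelCol, Fin.val_last]
    split_ifs <;> first | omega | rfl
  · simp [snocZero, stdRelCol]

lemma ker_monomialMap [IsDomain R] {x y : R} (hx0 : x ≠ 0) (hx : (Ideal.span {x}).IsPrime)
    (hy : y ∉ Ideal.span {x}) (r : ℕ) (hr : 1 ≤ r) :
    LinearMap.ker (monomialMap r x y) =
      Submodule.span R { v | ∃ k, k < r - 1 ∧ v = stdRelCol r x y k } := by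
  refine le_antisymm (fun c hc => ?_) ?_
  · rw [LinearMap.mem_ker] at hc
    obtain ⟨k, rfl⟩ := Nat.exists_eq_add_of_le' hr
    induction k with
    | zero =>
      have h0 : c = 0 := by
        ext i
        fin_cases i
        simpa [monomialMap_apply] using hc
      rw [h0]
      exact Submodule.zero_mem _
    | succ k ih =>
      have hdvd : c (Fin.last _) ∈ Ideal.span {x} := by
        have h : c (Fin.last _) * y ^ (k + 1) ∈ Ideal.span {x} := by
          rw [monomialMap_succ] at hc
          exact Ideal.mem_span_singleton.mpr
            ⟨-monomialMap (k + 1) x y (fun i => c i.castSucc), by linear_combination hc⟩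
        exact (hx.mem_or_mem h).resolve_right fun h => hy (hx.mem_of_pow_mem _ h)
      obtain ⟨d, hd⟩ := Ideal.mem_span_singleton.mp hdvd
      have hk : k < k + 2 - 1 := by omega
      set e := c + d • stdRelCol (k + 2) x y k with he
      have hlast : e (Fin.last _) = 0 := by
        simp [he, stdRelCol, hd, mul_comm]
      have hmap : monomialMap (k + 2) x y e = 0 := by
        rw [he, map_add, map_smul, monomialMap_stdRelCol x y hk, hc]
        simp
      have h_front : monomialMap (k + 1) x y (fun i => e i.castSucc) = 0 := by
        rw [monomialMap_succ, hlast, zero_mul, add_zero] at hmap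
        exact (mul_eq_zero.mp hmap).resolve_left hx0
      have hspan := Submodule.mem_map_of_mem (f := snocZero R (k + 1))
        (ih (by omega) _ h_front)
      have hsnoc : snocZero R (k + 1) (fun i => e i.castSucc) = e := by
        ext i
        refine Fin.lastCases ?_ (fun i => ?_) i <;> simp [snocZero, hlast]
      rw [hsnoc, Submodule.map_span] at hspan
      have hle : Submodule.span R (snocZero R (k + 1) ''
          { v | ∃ j, j < k + 1 - 1 ∧ v = stdRelCol (k + 1) x y j }) ≤
          Submodule.span R { v | ∃ j, j < k + 1 + 1 - 1 ∧ v = stdRelCol (k + 1 + 1) x y j } := by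
        refine Submodule.span_mono ?_
        rintro _ ⟨_, ⟨j, hj, rfl⟩, rfl⟩
        exact ⟨j, by omega, snocZero_stdRelCol x y hj⟩
      have hcol : stdRelCol (k + 1 + 1) x y k ∈
          Submodule.span R { v | ∃ j, j < k + 1 + 1 - 1 ∧ v = stdRelCol (k + 1 + 1) x y j } :=
        Submodule.subset_span ⟨k, hk, rfl⟩
      have hce : c = e - d • stdRelCol (k + 2) x y k := by rw [he, add_sub_cancel_right]
      rw [hce]
      exact Submodule.sub_mem _ (hle hspan) (Submodule.smul_mem _ _ hcol)
  · rw [Submodule.span_le]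
    rintro _ ⟨k, hk, rfl⟩
    exact monomialMap_stdRelCol x y hk

lemma range_monomialMap (r : ℕ) (hr : 1 ≤ r) (x y : R) :
    LinearMap.range (monomialMap r x y) = Ideal.span {x, y} ^ (r - 1) := by
  rw [monomialMap, Fintype.range_linearCombination]
  refine le_antisymm ?_ ?_
  · rw [Submodule.span_le]
    rintro _ ⟨i, rfl⟩
    have h : r - 1 = (r - 1 - (i : ℕ)) + i := by omega
    have hmem := Ideal.mul_mem_mul
      (Ideal.pow_mem_pow (Ideal.subset_span (by simp) : x ∈ Ideal.span {x, y}) (r - 1 - (i : ℕ)))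
      (Ideal.pow_mem_pow (Ideal.subset_span (by simp) : y ∈ Ideal.span {x, y}) (i : ℕ))
    rw [← pow_add, ← h] at hmem
    exact hmem
  · rw [Ideal.span_insert, ← Ideal.add_eq_sup, add_pow, Ideal.sum_eq_sup, Finset.sup_le_iff]
    intro j hj
    rw [Finset.mem_range] at hj
    refine Ideal.mul_le_left.trans ?_
    rw [Ideal.span_singleton_pow, Ideal.span_singleton_pow, Ideal.span_singleton_mul_span_singleton,
      Ideal.span_singleton_le_iff_mem]
    refine Submodule.subset_span ⟨⟨r - 1 - j, by omega⟩, ?_⟩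
    have h : r - 1 - (r - 1 - j) = j := by omega
    simp only [h]

lemma mrSpan_eq_comap [IsDomain R] {x y : R} (hx0 : x ≠ 0) (hx : (Ideal.span {x}).IsPrime)
    (hy : y ∉ Ideal.span {x}) {r : ℕ} (hr : 1 ≤ r) {m : ℕ} {a : Fin m → R}
    {C : Fin m → Fin r → R} (hC : ∀ j, Expresses r x y (C j) (a j)) :
    MrSpan r x y C = Submodule.comap (monomialMap r x y) (Ideal.span (Set.range a)) := by
  have hmap : (Submodule.span R (Set.range C)).map (monomialMap r x y) =
      Ideal.span (Set.range a) := by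
    rw [Submodule.map_span, ← Set.range_comp]
    congr 2
    ext j
    exact expresses_iff.mp (hC j)
  rw [MrSpan, Submodule.span_union, ← ker_monomialMap hx0 hx hy r hr, ← hmap,
    Submodule.comap_map_eq]

end MonomialMap

section MinimalLift

variable {R : Type*} [CommRing R] [IsLocalRing R] {r : ℕ}

lemma isUnit_of_forall_sub_mem_maximalIdeal (f : (Fin r → R) →ₗ[R] (Fin r → R))
    (hf : ∀ c i, f c i - c i ∈ maximalIdeal R) : IsUnit f := by
  rw [← LinearMap.isUnit_toMatrix'_iff, Matrix.isUnit_iff_isUnit_det]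
  refine isUnit_of_map_unit (residue R) _ ?_
  have h1 : (residue R).mapMatrix (LinearMap.toMatrix' f) = 1 := by
    ext i j
    have h := hf (Pi.single j 1) i
    rw [← residue_eq_zero_iff, map_sub, sub_eq_zero] at h
    rw [RingHom.mapMatrix_apply, Matrix.map_apply, LinearMap.toMatrix'_apply, h,
      Matrix.one_apply, Pi.single_apply]
    split_ifs <;> simp
  rw [RingHom.map_det, h1, Matrix.det_one]
  exact isUnit_one

lemma exists_linearEquiv_comp_eq {f g : (Fin r → R) →ₗ[R] R}
    (hrange : LinearMap.range f = LinearMap.range g)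
    (hf : ∀ c, f c = 0 → ∀ i, c i ∈ maximalIdeal R)
    (hg : ∀ c, g c = 0 → ∀ i, c i ∈ maximalIdeal R) :
    ∃ e : (Fin r → R) ≃ₗ[R] (Fin r → R), g ∘ₗ e.toLinearMap = f := by
  have lift : ∀ {f g : (Fin r → R) →ₗ[R] R}, LinearMap.range f = LinearMap.range g →
      ∃ s : (Fin r → R) →ₗ[R] (Fin r → R), g ∘ₗ s = f := fun {f g} h => by
    obtain ⟨s, hs⟩ := Module.projective_lifting_property g.rangeRestrict
      (f.codRestrict (LinearMap.range g) fun c => h ▸ LinearMap.mem_range_self f c)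
      g.surjective_rangeRestrict
    exact ⟨s, LinearMap.ext fun c => congrArg Subtype.val (LinearMap.congr_fun hs c)⟩
  obtain ⟨s, hs⟩ := lift hrange
  obtain ⟨t, ht⟩ := lift hrange.symm
  have hts : IsUnit (t ∘ₗ s) := isUnit_of_forall_sub_mem_maximalIdeal _ fun c i =>
    hf (t (s c) - c) (by
      rw [map_sub, ← LinearMap.comp_apply f, ht, ← LinearMap.comp_apply g, hs, sub_self]) i
  have hst : IsUnit (s ∘ₗ t) := isUnit_of_forall_sub_mem_maximalIdeal _ fun c i =>
    hg (s (t c) - c) (by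
      rw [map_sub, ← LinearMap.comp_apply g, hs, ← LinearMap.comp_apply f, ht, sub_self]) i
  rw [Module.End.isUnit_iff] at hts hst
  rw [LinearMap.coe_comp] at hts hst
  exact ⟨LinearEquiv.ofBijective s ⟨hts.1.of_comp, hst.2.of_comp⟩, hs⟩

end MinimalLift

lemma mem_maximalIdeal_of_mem_span_stdRelCol {R : Type*} [CommRing R] [IsLocalRing R] {x y : R}
    (hx : x ∈ maximalIdeal R) (hy : y ∈ maximalIdeal R) {r : ℕ} {c : Fin r → R}
    (hc : c ∈ Submodule.span R { v | ∃ k, k < r - 1 ∧ v = stdRelCol r x y k }) (i : Fin r) :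
    c i ∈ maximalIdeal R := by
  have hle : Submodule.span R { v | ∃ k, k < r - 1 ∧ v = stdRelCol r x y k } ≤
      Submodule.comap (LinearMap.proj i : (Fin r → R) →ₗ[R] R) (maximalIdeal R) := by
    rw [Submodule.span_le]
    rintro _ ⟨k, -, rfl⟩
    simp only [SetLike.mem_coe, Submodule.mem_comap, LinearMap.proj_apply, stdRelCol]
    split_ifs
    exacts [hy, neg_mem hx, zero_mem _]
  exact hle hc

/-- the module `M_r(I)` is, up to isomorphism, independent of the chosen
minimal generating set of `I`, of the regular system of parameters generating `𝔪`, and of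
the coefficients expressing the generators in terms of `x^(r-1), …, y^(r-1)`. -/
theorem statement1 (R : Type*) [CommRing R] [IsLocalRing R]
    (hreg : IsTwoDimRegularLocal R) [Infinite (IsLocalRing.ResidueField R)]
    (I : Ideal R) (hI : IsMPrimary I)
    (m r n : ℕ) (hord : ordEQ I m) (hr2 : 2 ≤ r) (hrm : r ≤ m)
    (x y : R) (a : Fin (n + 1) → R) (C : Fin (n + 1) → Fin r → R)
    (u v : R) (b : Fin (n + 1) → R) (D : Fin (n + 1) → Fin r → R)
    (h1 : IsMrPresentation r I x y a C)
    (h2 : IsMrPresentation r I u v b D) :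
    Nonempty (↥(MrSpan r x y C) ≃ₗ[R] ↥(MrSpan r u v D)) := by
  obtain ⟨hnoeth, hdim, -⟩ := hreg
  obtain ⟨hxy, ⟨haI, -⟩, hC⟩ := h1
  obtain ⟨huv, ⟨hbI, -⟩, hD⟩ := h2
  have hdom := isDomain_of_maximalIdeal_eq hdim hxy
  have hr : 1 ≤ r := by omega
  have params : ∀ {z w : R}, maximalIdeal R = Ideal.span {z, w} →
      z ≠ 0 ∧ (Ideal.span {z}).IsPrime ∧ w ∉ Ideal.span {z} := fun {z w} h => by
    have h' : maximalIdeal R = Ideal.span {w, z} := h.trans (by rw [Set.pair_comm])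
    refine ⟨fun h0 => ?_, isPrime_span_singleton_of_maximalIdeal_eq hdim h, fun hw => ?_⟩
    · exact pow_notMem_span_singleton_of_maximalIdeal_eq hdim h' 1 (by simp [h0])
    · exact pow_notMem_span_singleton_of_maximalIdeal_eq hdim h 1 (by simpa using hw)
  have minimal : ∀ {z w : R}, maximalIdeal R = Ideal.span {z, w} →
      ∀ c, monomialMap r z w c = 0 → ∀ i, c i ∈ maximalIdeal R := fun {z w} h c hc i => by
    obtain ⟨hz0, hz, hw⟩ := params h
    rw [← LinearMap.mem_ker, ker_monomialMap hz0 hz hw r hr] at hc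
    exact mem_maximalIdeal_of_mem_span_stdRelCol (h ▸ Ideal.subset_span (by simp))
      (h ▸ Ideal.subset_span (by simp)) hc i
  obtain ⟨hx0, hx, hy⟩ := params hxy
  obtain ⟨hu0, hu, hv⟩ := params huv
  obtain ⟨e, he⟩ := exists_linearEquiv_comp_eq (f := monomialMap r x y) (g := monomialMap r u v)
    (by rw [range_monomialMap r hr, range_monomialMap r hr, ← hxy, ← huv])
    (minimal hxy) (minimal huv)
  rw [mrSpan_eq_comap hx0 hx hy hr hC, mrSpan_eq_comap hu0 hu hv hr hD, haI, hbI, ← he,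
    Submodule.comap_comp]
  exact ⟨e.ofSubmodule' _⟩
end

section
/- Let (R, 𝔪) be a two-dimensional regular local ring with infinite residue field, let I be an integrally closed 𝔪-primary ideal with ord(I) = n ≥ r ≥ 2, and let M = M_r(I). Then I_k(M) = 𝔪^k for k = 1, 2, …, r−1, and I_r(M) = I(M) = I. -/
open IsLocalRing

section Helpers

variable {R : Type*} [CommRing R]

theorem span_pair_pow_eq_span_monomials (x y : R) (d : ℕ) :
    Ideal.span {x, y} ^ d =
      Ideal.span (Set.range fun i : Fin (d + 1) => x ^ (d - (i : ℕ)) * y ^ (i : ℕ)) := by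
  apply le_antisymm
  · induction d with
    | zero => simp [Ideal.one_eq_top]
    | succ d ih =>
      rw [pow_succ']
      refine (Ideal.mul_mono_right ih).trans ?_
      rw [Ideal.span_mul_span', Ideal.span_le]
      rintro _ ⟨u, hu, _, ⟨i, rfl⟩, rfl⟩
      apply Ideal.subset_span
      have hi : d + 1 - (i : ℕ) = (d - i) + 1 := by have := i.2; omega
      rcases hu with rfl | rfl
      · refine ⟨i.castSucc, ?_⟩
        simp only [Fin.val_castSucc, hi]
        ring
      · refine ⟨i.succ, ?_⟩
        simp only [Fin.val_succ, Nat.add_sub_add_right]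
        ring
  · rw [Ideal.span_le]
    rintro _ ⟨i, rfl⟩
    have hi : d = (d - (i : ℕ)) + i := by have := i.2; omega
    have hx : x ∈ Ideal.span {x, y} := Ideal.subset_span (by simp)
    have hy : y ∈ Ideal.span {x, y} := Ideal.subset_span (by simp)
    have := Ideal.mul_mem_mul (Ideal.pow_mem_pow hx (d - (i : ℕ))) (Ideal.pow_mem_pow hy i)
    rwa [← pow_add, ← hi] at this

theorem exists_form_of_mem_mul_pow {x y z : R} {J : Ideal R} {d : ℕ}
    (hz : z ∈ J * Ideal.span {x, y} ^ d) :
    ∃ c : Fin (d + 1) → R, (∀ i, c i ∈ J) ∧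
      z = ∑ i, c i * (x ^ (d - (i : ℕ)) * y ^ (i : ℕ)) := by
  rw [span_pair_pow_eq_span_monomials, ← smul_eq_mul, Ideal.span,
    Submodule.mem_ideal_smul_span_iff_exists_sum] at hz
  obtain ⟨c, hc, rfl⟩ := hz
  exact ⟨c, hc, Finsupp.sum_fintype _ _ (by simp)⟩

theorem Polynomial.exists_eval_ne_zero_of_ne_zero {K : Type*} [Field K] [Infinite K]
    {p : Polynomial K} (hp : p ≠ 0) : ∃ t, p.eval t ≠ 0 := by
  by_contra! h
  exact hp (Polynomial.funext fun t => by simp [h t])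

/-- A form with a unit coefficient cannot vanish at a pair of generators of the maximal ideal:
after a linear change of coordinates, a power of `x` would be a multiple of a single element `w`
with `𝔪 = (x, w)`, contradicting Krull's principal ideal theorem. -/
theorem mem_maximalIdeal_of_form_eq_zero [IsLocalRing R] (hreg : IsTwoDimRegularLocal R)
    [Infinite (ResidueField R)] {x y : R} (hxy : maximalIdeal R = Ideal.span {x, y}) {d : ℕ}
    {c : Fin (d + 1) → R} (h : ∑ i, c i * (x ^ (d - (i : ℕ)) * y ^ (i : ℕ)) = 0)
    (i : Fin (d + 1)) : c i ∈ maximalIdeal R := by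
  by_contra hi
  have : IsNoetherianRing R := hreg.1
  let p : Polynomial (ResidueField R) :=
    ∑ j : Fin (d + 1), Polynomial.monomial (j : ℕ) (residue R (c j))
  have hp : p ≠ 0 := by
    intro hp
    have := congrArg (fun q => q.coeff (i : ℕ)) hp
    simp only [p, Polynomial.finsetSum_coeff, Polynomial.coeff_monomial, Polynomial.coeff_zero,
      Fin.val_inj, Finset.sum_ite_eq', Finset.mem_univ, if_true] at this
    exact hi (Ideal.Quotient.eq_zero_iff_mem.mp this)
  obtain ⟨s, hs⟩ := Polynomial.exists_eval_ne_zero_of_ne_zero hp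
  obtain ⟨t, rfl⟩ := residue_surjective s
  have hu : IsUnit (∑ j, c j * t ^ (j : ℕ)) := by
    rw [← residue_ne_zero_iff_isUnit]
    simpa [p, Polynomial.eval_finsetSum] using hs
  set w := y - t * x with hw
  have hwm : w ∈ maximalIdeal R := by
    rw [hxy]
    exact Ideal.mem_span_pair.mpr ⟨-t, 1, by rw [hw]; ring⟩
  have hmod : x ^ d ∈ Ideal.span {w} := by
    have hyt : Ideal.Quotient.mk (Ideal.span {w}) y = Ideal.Quotient.mk _ (t * x) :=
      Ideal.Quotient.eq.mpr (Ideal.mem_span_singleton_self w)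
    have h' : x ^ d * ∑ j, c j * t ^ (j : ℕ) ∈ Ideal.span {w} := by
      rw [← Ideal.Quotient.eq_zero_iff_mem, ← map_zero (Ideal.Quotient.mk (Ideal.span {w})), ← h]
      simp only [map_sum, map_mul, map_pow, hyt, Finset.mul_sum]
      refine Finset.sum_congr rfl fun j _ => ?_
      have hj : d = (d - (j : ℕ)) + j := by have := j.2; omega
      have hpow : x ^ d = x ^ (d - (j : ℕ)) * x ^ (j : ℕ) := by rw [← pow_add, ← hj]
      rw [← map_pow, hpow, map_mul, map_pow, map_pow]
      ring
    rwa [mul_comm, Ideal.unit_mul_mem_iff_mem _ hu] at h'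
  have hmin : maximalIdeal R ∈ (Ideal.span {w}).minimalPrimes := by
    refine ⟨⟨inferInstance, (Ideal.span_singleton_le_iff_mem _).mpr hwm⟩, ?_⟩
    rintro q ⟨hq, hwq⟩ -
    have hxq : x ∈ q := hq.mem_of_pow_mem d (hwq hmod)
    have hwq' : w ∈ q := hwq (Ideal.mem_span_singleton_self w)
    rw [hxy, Ideal.span_le]
    rintro _ (rfl | rfl)
    · exact hxq
    · have := q.add_mem hwq' (q.mul_mem_left t hxq)
      simpa [hw] using this
  have h1 := Ideal.height_le_one_of_isPrincipal_of_mem_minimalPrimes _ _ hmin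
  have h2 := IsLocalRing.maximalIdeal_height_eq_ringKrullDim (R := R)
  rw [hreg.2.1] at h2
  have h3 : ((maximalIdeal R).height : WithBot ℕ∞) ≤ 1 := by exact_mod_cast h1
  rw [h2] at h3
  exact absurd h3 (by decide)

theorem mem_maximalIdeal_of_form_mem_pow [IsLocalRing R] (hreg : IsTwoDimRegularLocal R)
    [Infinite (ResidueField R)] {x y : R} (hxy : maximalIdeal R = Ideal.span {x, y}) {d : ℕ}
    {c : Fin (d + 1) → R}
    (h : ∑ i, c i * (x ^ (d - (i : ℕ)) * y ^ (i : ℕ)) ∈ maximalIdeal R ^ (d + 1))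
    (i : Fin (d + 1)) : c i ∈ maximalIdeal R := by
  have h' := h
  rw [pow_succ', hxy] at h'
  obtain ⟨e, he, hsum⟩ := exists_form_of_mem_mul_pow h'
  have h0 : ∑ i, (c i - e i) * (x ^ (d - (i : ℕ)) * y ^ (i : ℕ)) = 0 := by
    simp only [sub_mul, Finset.sum_sub_distrib]
    exact sub_eq_zero.mpr hsum
  have := mem_maximalIdeal_of_form_eq_zero hreg hxy h0 i
  have hei := he i
  rw [← hxy] at hei
  simpa using (maximalIdeal R).add_mem this hei

theorem Matrix.det_mem_pow {n : ℕ} {J : Ideal R} {A : Matrix (Fin n) (Fin n) R}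
    (hA : ∀ i j, A i j ∈ J) : A.det ∈ J ^ n := by
  rw [Matrix.det_apply]
  refine Ideal.sum_mem _ fun σ _ => ?_
  rw [Units.smul_def, zsmul_eq_mul]
  apply Ideal.mul_mem_left
  simpa using Ideal.prod_mem_prod (s := Finset.univ) (I := fun _ : Fin n => J)
    fun i _ => hA (σ i) i

/-- The bidiagonal matrix obtained from `k` consecutive Koszul columns by deleting row `p` has
determinant `y ^ p * (-x) ^ (k - p)`. -/
theorem det_stdRelCol_succAbove (k : ℕ) {r : ℕ} (hk : k + 1 ≤ r) (x y : R) (p : Fin (k + 1)) :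
    Matrix.det (Matrix.of fun i j : Fin k =>
      stdRelCol r x y (j : ℕ) (Fin.castLE hk (p.succAbove i))) =
      y ^ (p : ℕ) * (-x) ^ (k - (p : ℕ)) := by
  let b : Fin k → ℕ := fun i => if (i : ℕ) < p then p - i else k + i
  have hb : Function.Injective b := by
    intro i j hij
    have := p.2
    have := i.2
    have := j.2
    simp only [b] at hij
    ext
    split_ifs at hij <;> omega
  have hval : ∀ i : Fin k, ((p.succAbove i : Fin (k + 1)) : ℕ) =
      if (i : ℕ) < p then (i : ℕ) else i + 1 := by
    intro i
    rw [Fin.succAbove]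
    simp only [Fin.lt_def, Fin.val_castSucc]
    split_ifs <;> simp
  have key := @Matrix.det_of_isUpperTriangular (Fin k) R
    (Matrix.of fun i j : Fin k => stdRelCol r x y (j : ℕ) (Fin.castLE hk (p.succAbove i)))
    _ _ _ (LinearOrder.lift' b hb) (by
      intro i j hij
      have hij' : b j < b i := hij
      have := p.2
      have := i.2
      have := j.2
      simp only [b] at hij'
      simp only [Matrix.of_apply, stdRelCol, Fin.val_castLE, hval]
      rw [if_neg, if_neg] <;> split_ifs at hij' ⊢ <;> omega)
  rw [key]
  have hdiag : ∀ i : Fin k, Matrix.of (fun i j : Fin k =>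
      stdRelCol r x y (j : ℕ) (Fin.castLE hk (p.succAbove i))) i i =
      if (i : ℕ) < p then y else -x := by
    intro i
    simp only [Matrix.of_apply, stdRelCol, Fin.val_castLE, hval]
    split_ifs <;> first | rfl | omega
  rw [Finset.prod_congr rfl fun i _ => hdiag i,
    Fin.prod_univ_eq_prod_range (fun i => if i < (p : ℕ) then y else -x) k,
    ← Finset.prod_range_mul_prod_Ico _ (Nat.lt_succ_iff.mp p.2)]
  congr 1
  · rw [Finset.prod_congr rfl fun i hi => if_pos (Finset.mem_range.mp hi)]
    simp
  · rw [Finset.prod_congr rfl fun i hi => if_neg (Finset.mem_Ico.mp hi).1.not_gt]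
    simp

/-- Evaluation of a coefficient vector of length `d + 1` at the monomials of degree `d`. -/
def formEval (d : ℕ) (x y : R) : (Fin (d + 1) → R) →ₗ[R] R :=
  Fintype.linearCombination R fun i : Fin (d + 1) => x ^ (d - (i : ℕ)) * y ^ (i : ℕ)

theorem formEval_apply (d : ℕ) (x y : R) (v : Fin (d + 1) → R) :
    formEval d x y v = ∑ i, v i * (x ^ (d - (i : ℕ)) * y ^ (i : ℕ)) := by
  simp [formEval, Fintype.linearCombination_apply]

theorem formEval_stdRelCol {d k : ℕ} (hk : k < d) (x y : R) :
    formEval d x y (stdRelCol (d + 1) x y k) = 0 := by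
  have hne : (⟨k, by omega⟩ : Fin (d + 1)) ≠ ⟨k + 1, by omega⟩ := by simp
  rw [formEval_apply, Fintype.sum_eq_add _ _ hne]
  · have : d - k = d - (k + 1) + 1 := by omega
    simp only [stdRelCol, if_true, this]
    rw [if_neg (by omega)]
    ring
  · rintro i ⟨h1, h2⟩
    simp only [stdRelCol, ne_eq, Fin.ext_iff] at h1 h2 ⊢
    simp [h1, h2]

theorem apply_mem_of_mem_MrSpan {J : Ideal R} {r m : ℕ} {x y : R} {C : Fin m → Fin r → R}
    (hx : x ∈ J) (hy : y ∈ J) (hC : ∀ j i, C j i ∈ J) {v : Fin r → R}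
    (hv : v ∈ MrSpan r x y C) (i : Fin r) : v i ∈ J := by
  have hle : MrSpan r x y C ≤ Submodule.comap (LinearMap.proj i) J := by
    refine Submodule.span_le.mpr ?_
    rintro _ (⟨j, rfl⟩ | ⟨k, -, rfl⟩)
    · exact hC j i
    · change stdRelCol r x y k i ∈ J
      unfold stdRelCol
      split_ifs
      · exact hy
      · exact J.neg_mem hx
      · exact J.zero_mem
  exact hle hv

theorem formEval_mem_of_mem_MrSpan {I : Ideal R} {d m : ℕ} {x y : R}
    {C : Fin m → Fin (d + 1) → R} (hC : ∀ j, formEval d x y (C j) ∈ I)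
    {v : Fin (d + 1) → R} (hv : v ∈ MrSpan (d + 1) x y C) : formEval d x y v ∈ I := by
  have hle : MrSpan (d + 1) x y C ≤ Submodule.comap (formEval d x y) I := by
    refine Submodule.span_le.mpr ?_
    rintro _ (⟨j, rfl⟩ | ⟨k, hk, rfl⟩)
    · exact hC j
    · change formEval d x y (stdRelCol (d + 1) x y k) ∈ I
      rw [formEval_stdRelCol (by omega)]
      exact I.zero_mem
  exact hle hv

theorem stdRelCol_mem_MrSpan {r m k : ℕ} (hk : k < r - 1) (x y : R) (C : Fin m → Fin r → R) :
    stdRelCol r x y k ∈ MrSpan r x y C :=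
  Submodule.subset_span (Or.inr ⟨k, hk, rfl⟩)

theorem minorsIdeal_le_pow {J : Ideal R} {r : ℕ} {M : Submodule R (Fin r → R)}
    (hM : ∀ v ∈ M, ∀ i, v i ∈ J) (k : ℕ) : minorsIdeal k M ≤ J ^ k := by
  refine Ideal.span_le.mpr ?_
  rintro _ ⟨w, ρ, -, hw, rfl⟩
  exact Matrix.det_mem_pow fun i j => hM _ (hw j) _

theorem pow_le_minorsIdeal_MrSpan {r m k : ℕ} (hk : k + 1 ≤ r) (x y : R)
    (C : Fin m → Fin r → R) : Ideal.span {x, y} ^ k ≤ minorsIdeal k (MrSpan r x y C) := by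
  rw [span_pair_pow_eq_span_monomials, Ideal.span_le]
  rintro _ ⟨p, rfl⟩
  have hmem : y ^ (p : ℕ) * (-x) ^ (k - (p : ℕ)) ∈ minorsIdeal k (MrSpan r x y C) := by
    rw [← det_stdRelCol_succAbove k hk x y p]
    refine Ideal.subset_span ⟨fun j => stdRelCol r x y j, fun i => Fin.castLE hk (p.succAbove i),
      (Fin.castLE_injective hk).comp Fin.succAbove_right_injective, fun j => ?_, rfl⟩
    exact stdRelCol_mem_MrSpan (by have := j.2; omega) x y C
  have := Ideal.mul_mem_left _ ((-1) ^ (k - (p : ℕ))) hmem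
  rwa [mul_left_comm, ← mul_pow, neg_one_mul, neg_neg, mul_comm] at this

/-- The determinant with first column `v` and remaining columns the Koszul columns is, up to
sign, the value of the form with coefficients `v`. -/
theorem colDet_cons_stdRelCol (d : ℕ) (x y : R) (v : Fin (d + 1) → R) :
    colDet (Fin.cons v fun j : Fin d => stdRelCol (d + 1) x y j : Fin (d + 1) → Fin (d + 1) → R) =
      (-1) ^ d * formEval d x y v := by
  rw [colDet, Matrix.det_succ_column_zero, formEval_apply, Finset.mul_sum]
  refine Finset.sum_congr rfl fun p _ => ?_
  have hsub : (Matrix.of fun i j => (Fin.cons v fun j : Fin d => stdRelCol (d + 1) x y j :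
      Fin (d + 1) → Fin (d + 1) → R) j i).submatrix p.succAbove Fin.succ =
      Matrix.of fun i j : Fin d =>
        stdRelCol (d + 1) x y (j : ℕ) (Fin.castLE le_rfl (p.succAbove i)) := by
    ext i j
    simp
  have hp : d = (p : ℕ) + (d - p) := by have := p.2; omega
  have hpow : (-1 : R) ^ d = (-1) ^ (p : ℕ) * (-1) ^ (d - (p : ℕ)) := by
    rw [← pow_add, ← hp]
  rw [hsub, det_stdRelCol_succAbove, hpow, neg_pow x]
  simp only [Matrix.of_apply, Fin.cons_zero]
  ring

theorem formEval_mem_maxMinors {d m : ℕ} {x y : R} {C : Fin m → Fin (d + 1) → R}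
    {v : Fin (d + 1) → R} (hv : v ∈ MrSpan (d + 1) x y C) :
    formEval d x y v ∈ maxMinors (MrSpan (d + 1) x y C) := by
  have hmem : (-1) ^ d * formEval d x y v ∈ maxMinors (MrSpan (d + 1) x y C) := by
    rw [← colDet_cons_stdRelCol]
    refine Ideal.subset_span ⟨_, fun j => ?_, rfl⟩
    refine Fin.cases hv (fun j => ?_) j
    exact stdRelCol_mem_MrSpan (by have := j.2; omega) x y C
  exact (Ideal.unit_mul_mem_iff_mem _ (isUnit_one.neg.pow d)).mp hmem

theorem maxMinors_le_minorsIdeal {r : ℕ} (M : Submodule R (Fin r → R)) :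
    maxMinors M ≤ minorsIdeal r M := by
  refine Ideal.span_mono ?_
  rintro _ ⟨w, hw, rfl⟩
  exact ⟨w, id, Function.injective_id, hw, rfl⟩

theorem minorsIdeal_le_maxMinors {r : ℕ} (M : Submodule R (Fin r → R)) :
    minorsIdeal r M ≤ maxMinors M := by
  refine Ideal.span_le.mpr ?_
  rintro _ ⟨w, ρ, hρ, hw, rfl⟩
  let σ : Equiv.Perm (Fin r) := Equiv.ofBijective ρ (Finite.injective_iff_bijective.mp hρ)
  have : Matrix.det (Matrix.of fun i j => w j (ρ i)) = Equiv.Perm.sign σ * colDet w :=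
    Matrix.det_permute σ (Matrix.of fun i j => w j i)
  rw [this]
  exact Ideal.mul_mem_left _ _ (Ideal.subset_span ⟨w, hw, rfl⟩)

/-- The determinant trick: the module `N` need not be faithful as long as it contains `z`. -/
theorem memIntClosure_of_mul_mem [IsNoetherianRing R] {I N : Ideal R} {z : R} (hzN : z ∈ N)
    (hz : ∀ u ∈ N, z * u ∈ I * N) : MemIntClosure I z := by
  let f : Module.End R N := algebraMap R (Module.End R N) z
  have hf : LinearMap.range f ≤ I • (⊤ : Submodule R N) := by
    rintro _ ⟨u, rfl⟩
    have h := hz u u.2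
    have hmap : (I • (⊤ : Submodule R N)).map N.subtype = I * N := by
      rw [Submodule.map_smul'', Submodule.map_top, Submodule.range_subtype, smul_eq_mul]
    rw [← hmap] at h
    obtain ⟨t, ht, hte⟩ := h
    have : f u = t := Subtype.ext hte.symm
    rwa [this]
  obtain ⟨p, hp, -, hcoeff, hpf⟩ :=
    LinearMap.exists_monic_and_natDegree_eq_and_coeff_mem_pow_and_aeval_eq_zero R f I hf
  have h0 : p.eval z * z = 0 := by
    rw [Polynomial.aeval_algebraMap_apply] at hpf
    have := congrArg (fun g : Module.End R N => ((g ⟨z, hzN⟩ : N) : R)) hpf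
    simpa using this
  refine ⟨p.natDegree + 1, Nat.succ_pos _,
    fun i => if i ≤ p.natDegree then p.coeff (p.natDegree - i) else 0, ?_, ?_⟩
  · intro i _
    dsimp only
    split_ifs with hi
    · have := hcoeff (p.natDegree - i)
      rwa [Nat.sub_sub_self hi] at this
    · exact Ideal.zero_mem _
  · have hsum := Finset.sum_Ico_add' (fun i =>
      (if i ≤ p.natDegree then p.coeff (p.natDegree - i) else 0) * z ^ (p.natDegree + 1 - i))
      0 (p.natDegree + 1) 1
    have hIcc : Finset.Icc 1 (p.natDegree + 1) = Finset.Ico (0 + 1) (p.natDegree + 1 + 1) := by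
      ext
      simp
    rw [hIcc, ← hsum, ← Finset.range_eq_Ico, Finset.sum_range_succ, if_neg (by omega), zero_mul,
      add_zero, ← h0, Polynomial.eval_eq_sum_range, ← Finset.sum_range_reflect,
      Finset.sum_range_succ, add_mul, Finset.sum_mul, add_comm]
    congr 1
    · refine Finset.sum_congr rfl fun i hi => ?_
      have hi := Finset.mem_range.mp hi
      have h1 : p.natDegree - 1 - i + 1 = p.natDegree - i := by omega
      have h2 : p.natDegree + 1 - (p.natDegree - i) = i + 1 := by omega
      rw [if_pos (by omega), h1, h2, Nat.sub_sub_self hi.le, pow_succ, mul_assoc]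
    · simp [hp.coeff_natDegree, pow_succ]

theorem maxMinors_MrSpan_le [IsNoetherianRing R] {I : Ideal R} (hI : IdealIntClosed I)
    {d m : ℕ} {x y : R} {C : Fin m → Fin (d + 1) → R}
    (hC : ∀ j, formEval d x y (C j) ∈ I) (hCm : ∀ j i, C j i ∈ Ideal.span {x, y}) :
    maxMinors (MrSpan (d + 1) x y C) ≤ I := by
  refine Ideal.span_le.mpr ?_
  rintro _ ⟨w, hw, rfl⟩
  have hwm : ∀ j i, w j i ∈ Ideal.span {x, y} := fun j i =>
    apply_mem_of_mem_MrSpan (Ideal.subset_span (by simp)) (Ideal.subset_span (by simp))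
      hCm (hw j) i
  refine hI _ (memIntClosure_of_mul_mem (N := Ideal.span {x, y} ^ d)
    (Ideal.pow_le_pow_right d.le_succ (Matrix.det_mem_pow fun i j => hwm j i)) ?_)
  let A : Matrix (Fin (d + 1)) (Fin (d + 1)) R := Matrix.of fun i j => w j i
  let b : Fin (d + 1) → R := fun i => x ^ (d - (i : ℕ)) * y ^ (i : ℕ)
  have hbA : ∀ j, Matrix.vecMul b A j ∈ I := by
    intro j
    have := formEval_mem_of_mem_MrSpan hC (hw j)
    rw [formEval_apply] at this
    simpa only [Matrix.vecMul, dotProduct, A, b, Matrix.of_apply, mul_comm (w j _)] using this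
  have hadj : ∀ i j, A.adjugate i j ∈ Ideal.span {x, y} ^ d := by
    intro i j
    rw [Matrix.adjugate_fin_succ_eq_det_submatrix]
    exact Ideal.mul_mem_left _ _ (Matrix.det_mem_pow fun _ _ => hwm _ _)
  intro u hu
  rw [span_pair_pow_eq_span_monomials] at hu
  induction hu using Submodule.span_induction with
  | mem u hu =>
    obtain ⟨i, rfl⟩ := hu
    have hcr : A.det * b i = ∑ j, Matrix.vecMul b A j * A.adjugate j i := by
      have := congrFun (congrArg (Matrix.vecMul b) A.mul_adjugate) i
      rw [← Matrix.vecMul_vecMul, Matrix.vecMul_smul, Matrix.vecMul_one] at this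
      exact this.symm
    change A.det * b i ∈ _
    rw [hcr]
    exact Ideal.sum_mem _ fun j _ => Ideal.mul_mem_mul (hbA j) (hadj j i)
  | zero => simp
  | add u v _ _ hu hv => rw [mul_add]; exact Ideal.add_mem _ hu hv
  | smul t u _ hu => rw [smul_eq_mul, mul_left_comm]; exact Ideal.mul_mem_left _ _ hu

end Helpers

/-- for an integrally closed `𝔪`-primary ideal `I` with `ord(I) = n ≥ r ≥ 2`
and `M = M_r(I)`, we have `I_k(M) = 𝔪^k` for `1 ≤ k ≤ r - 1` and `I_r(M) = I(M) = I`. -/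
theorem statement3 (R : Type*) [CommRing R] [IsLocalRing R]
    (hreg : IsTwoDimRegularLocal R) [Infinite (IsLocalRing.ResidueField R)]
    (I : Ideal R) (hIc : IdealIntClosed I) (hIp : IsMPrimary I)
    (r n : ℕ) (hr : 2 ≤ r) (hrn : r ≤ n) (hord : ordEQ I n)
    (m : ℕ) (x y : R) (a : Fin (m + 1) → R) (C : Fin (m + 1) → Fin r → R)
    (hpres : IsMrPresentation r I x y a C) :
    (∀ k, 1 ≤ k → k ≤ r - 1 → minorsIdeal k (MrSpan r x y C) = maximalIdeal R ^ k) ∧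
    minorsIdeal r (MrSpan r x y C) = I ∧ maxMinors (MrSpan r x y C) = I := by
  obtain ⟨hxy, ⟨hspan, -⟩, hexp⟩ := hpres
  have : IsNoetherianRing R := hreg.1
  obtain ⟨d, rfl⟩ : ∃ d, r = d + 1 := ⟨r - 1, by omega⟩
  have hval : ∀ j, formEval d x y (C j) = a j := by
    intro j
    rw [hexp j, formEval_apply]
    exact Finset.sum_congr rfl fun i _ => (mul_assoc _ _ _).symm
  have haI : ∀ j, a j ∈ I := fun j => hspan ▸ Ideal.subset_span ⟨j, rfl⟩
  have hCm : ∀ j i, C j i ∈ maximalIdeal R := by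
    intro j
    apply mem_maximalIdeal_of_form_mem_pow hreg hxy
    rw [← formEval_apply, hval]
    exact Ideal.pow_le_pow_right hrn (hord.1 (haI j))
  have hmax : maxMinors (MrSpan (d + 1) x y C) = I := by
    refine le_antisymm (maxMinors_MrSpan_le hIc (fun j => hval j ▸ haI j) (hxy ▸ hCm)) ?_
    rw [← hspan, Ideal.span_le]
    rintro _ ⟨j, rfl⟩
    rw [← hval]
    exact formEval_mem_maxMinors (Submodule.subset_span (Or.inl ⟨j, rfl⟩))
  refine ⟨fun k _ hk => le_antisymm ?_ ?_, ?_, hmax⟩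
  · refine minorsIdeal_le_pow (fun v hv => apply_mem_of_mem_MrSpan ?_ ?_ hCm hv) k
    · exact hxy ▸ Ideal.subset_span (by simp)
    · exact hxy ▸ Ideal.subset_span (by simp)
  · rw [hxy]
    exact pow_le_minorsIdeal_MrSpan (by omega) x y C
  · rw [← hmax]
    exact le_antisymm (minorsIdeal_le_maxMinors _) (maxMinors_le_minorsIdeal _)
end

section
/- Let (R, 𝔪) be a two-dimensional regular local ring with infinite residue field and let M be a finitely generated torsion-free integrally closed R-module of rank r with ideal of maximal minors I = I(M) and without free direct summands, regarded as a submodule of F = M**. Then λ(R/I) − λ(F/M) ≥ r(r−1)/2, where λ denotes length. -/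
open IsLocalRing

section Length

variable {R : Type*} [CommRing R]

lemma Module.length_le_add_of_exact {A B C : Type*} [AddCommGroup A] [AddCommGroup B]
    [AddCommGroup C] [Module R A] [Module R B] [Module R C] (f : A →ₗ[R] B) (g : B →ₗ[R] C)
    (h : Function.Exact f g) :
    Module.length R B ≤ Module.length R A + Module.length R C := by
  rw [Module.length_eq_add_of_exact (LinearMap.ker g).subtype (LinearMap.ker g).mkQ
    (Submodule.subtype_injective _) (Submodule.mkQ_surjective _)
    (LinearMap.exact_subtype_mkQ _)]
  refine add_le_add ?_ ?_
  · rw [LinearMap.exact_iff.mp h]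
    exact Module.length_le_of_surjective f.rangeRestrict f.surjective_rangeRestrict
  · exact Module.length_le_of_injective ((LinearMap.ker g).liftQ g le_rfl)
      (LinearMap.ker_eq_bot.mp (Submodule.ker_liftQ_eq_bot _ _ _ le_rfl))

lemma Module.length_add_le_of_comp_eq_zero {A B C : Type*} [AddCommGroup A] [AddCommGroup B]
    [AddCommGroup C] [Module R A] [Module R B] [Module R C] (f : A →ₗ[R] B) (g : B →ₗ[R] C)
    (hf : Function.Injective f) (hg : Function.Surjective g) (h : g ∘ₗ f = 0) :
    Module.length R A + Module.length R C ≤ Module.length R B := by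
  rw [Module.length_eq_add_of_exact f (LinearMap.range f).mkQ hf
    (Submodule.mkQ_surjective _) (LinearMap.exact_map_mkQ_range f)]
  refine add_le_add le_rfl ?_
  have hle : LinearMap.range f ≤ LinearMap.ker g := by
    rintro _ ⟨a, rfl⟩
    exact LinearMap.congr_fun h a
  refine Module.length_le_of_surjective ((LinearMap.range f).liftQ g hle) ?_
  intro c
  obtain ⟨b, rfl⟩ := hg c
  exact ⟨Submodule.Quotient.mk b, by simp⟩

end Length

section PID

variable {D : Type*} [CommRing D] [IsDomain D]

lemma Ring.ord_prod {ι : Type*} (s : Finset ι) (a : ι → D) (ha : ∀ i, a i ≠ 0) :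
    Ring.ord D (∏ i ∈ s, a i) = ∑ i ∈ s, Ring.ord D (a i) := by
  classical
  induction s using Finset.induction_on with
  | empty => simp
  | insert i s hi ih =>
    rw [Finset.prod_insert hi, Finset.sum_insert hi, Ring.ord_mul, ih]
    exact mem_nonZeroDivisors_of_ne_zero (Finset.prod_ne_zero_iff.mpr fun j _ => ha j)

variable [IsPrincipalIdealRing D]

/-- Over a principal ideal domain, the colength of a lattice of full rank is the order of
the determinant of a basis. -/
lemma exists_columns_length_eq_ord {r : ℕ} (L : Submodule D (Fin r → D)) (d : D) (hd : d ≠ 0)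
    (hL : ∀ v, d • v ∈ L) :
    ∃ A : Fin r → Fin r → D, L = Submodule.span D (Set.range A) ∧
      Module.length D ((Fin r → D) ⧸ L) = Ring.ord D (colDet A) := by
  classical
  let b := Pi.basisFun D (Fin r)
  have hr : Module.finrank D L = Module.finrank D (Fin r → D) := by
    refine le_antisymm L.finrank_le ?_
    refine LinearMap.finrank_le_finrank_of_injective
      (f := (LinearMap.lsmul D (Fin r → D) d).codRestrict L hL) ?_
    intro u v h
    have h' : d • u = d • v := congrArg Subtype.val h
    exact smul_right_injective _ hd h'
  let t := Submodule.smithNormalFormTopBasis b hr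
  let s := Submodule.smithNormalFormBotBasis b hr
  let a := Submodule.smithNormalFormCoeffs b hr
  have hs : ∀ i, (s i : Fin r → D) = a i • t i := Submodule.smithNormalFormBotBasis_def b hr
  have ha : ∀ i, a i ≠ 0 := Submodule.smithNormalFormCoeffs_ne_zero b hr
  refine ⟨fun i => s i, ?_, ?_⟩
  · have := s.span_eq
    have h2 := congrArg (Submodule.map L.subtype) this
    rw [Submodule.map_span, Submodule.map_subtype_top, ← Set.range_comp] at h2
    exact h2.symm
  · have hdet : colDet (fun i => (s i : Fin r → D)) = (∏ i, a i) * colDet (fun i => t i) := by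
      simp only [colDet, hs, Pi.smul_apply, smul_eq_mul]
      rw [← Matrix.det_mul_row]
      rfl
    have hu : IsUnit (colDet (fun i => t i)) := by
      have := b.isUnit_det t
      rw [Module.Basis.det_apply] at this
      convert this using 2
      rfl
    rw [hdet, Ring.ord_mul_of_isUnit_right hu, Ring.ord_prod _ _ ha,
      (L.quotientEquivPiSpan b hr).length_eq, Module.length_pi_of_fintype]
    rfl

end PID

section Minors

variable {R : Type*} [CommRing R] {r : ℕ}

lemma colDet_eq_detRowAlternating (w : Fin r → Fin r → R) :
    colDet w = Matrix.detRowAlternating w :=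
  Matrix.det_transpose (Matrix.of w)

lemma colDet_update_add (w : Fin r → Fin r → R) (j : Fin r) (u v : Fin r → R) :
    colDet (Function.update w j (u + v)) =
      colDet (Function.update w j u) + colDet (Function.update w j v) := by
  simp only [colDet_eq_detRowAlternating, AlternatingMap.map_update_add]

lemma colDet_update_smul (w : Fin r → Fin r → R) (j : Fin r) (c : R) (v : Fin r → R) :
    colDet (Function.update w j (c • v)) = c * colDet (Function.update w j v) := by
  simp only [colDet_eq_detRowAlternating, AlternatingMap.map_update_smul, smul_eq_mul]

lemma colDet_mem_maxMinors {M : Submodule R (Fin r → R)} {w : Fin r → Fin r → R}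
    (hw : ∀ j, w j ∈ M) : colDet w ∈ maxMinors M :=
  Ideal.subset_span ⟨w, hw, rfl⟩

lemma maxMinors_mono {M N : Submodule R (Fin r → R)} (h : M ≤ N) :
    maxMinors M ≤ maxMinors N := by
  refine Ideal.span_le.mpr ?_
  rintro _ ⟨w, hw, rfl⟩
  exact colDet_mem_maxMinors fun j => h (hw j)

lemma maxMinors_le_pow {I : Ideal R} {M : Submodule R (Fin r → R)}
    (h : ∀ w ∈ M, ∀ i, w i ∈ I) : maxMinors M ≤ I ^ r := by
  refine Ideal.span_le.mpr ?_
  rintro _ ⟨w, hw, rfl⟩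
  rw [SetLike.mem_coe, colDet, Matrix.det_apply]
  refine Ideal.sum_mem _ fun σ _ => ?_
  rw [Units.smul_def, zsmul_eq_mul]
  refine Ideal.mul_mem_left _ _ ?_
  have := Ideal.prod_mem_prod (s := Finset.univ) (I := fun _ : Fin r => I)
    (x := fun i => Matrix.of (fun i j => w j i) (σ i) i) fun i _ => h _ (hw i) _
  simpa using this

lemma pow_mem_maxMinors {M : Submodule R (Fin r → R)} {a : R} (h : ∀ v, a • v ∈ M) :
    a ^ r ∈ maxMinors M := by
  have h1 : colDet (fun j => a • (Pi.single j 1 : Fin r → R)) = a ^ r := by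
    have : (Matrix.of fun i j => (a • (Pi.single j 1 : Fin r → R)) i) =
        a • (1 : Matrix (Fin r) (Fin r) R) := by
      ext i j
      simp [Matrix.one_apply, Pi.single_apply]
    rw [colDet, this, Matrix.det_smul]
    simp
  rw [← h1]
  exact colDet_mem_maxMinors fun j => h _

lemma colDet_mem_span_of_mem_span (A w : Fin r → Fin r → R)
    (hw : ∀ j, w j ∈ Submodule.span R (Set.range A)) :
    colDet w ∈ Ideal.span {colDet A} := by
  have h : ∀ j, ∃ c : Fin r → R, ∑ k, c k • A k = w j := fun j =>
    (Submodule.mem_span_range_iff_exists_fun R).mp (hw j)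
  choose c hc using h
  have : (Matrix.of fun i j => w j i) =
      (Matrix.of fun i j => A j i) * Matrix.of fun k j => c j k := by
    ext i j
    simp [Matrix.mul_apply, ← hc, Finset.sum_apply, mul_comm]
  have h2 : colDet w = (Matrix.of fun i j => w j i).det := rfl
  rw [h2, this, Matrix.det_mul]
  exact Ideal.mul_mem_right _ _ (Ideal.mem_span_singleton_self _)

/-- The submodule `M :_F x`. -/
def colonSub (M : Submodule R (Fin r → R)) (x : R) : Submodule R (Fin r → R) :=
  M.comap (LinearMap.lsmul R (Fin r → R) x)

lemma mem_colonSub {M : Submodule R (Fin r → R)} {x : R} {v : Fin r → R} :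
    v ∈ colonSub M x ↔ x • v ∈ M := Iff.rfl

lemma le_colonSub (M : Submodule R (Fin r → R)) (x : R) : M ≤ colonSub M x :=
  fun _ h => M.smul_mem x h

lemma maxMinors_le_sup {M : Submodule R (Fin r → R)} {x : R} {A : Fin r → Fin r → R}
    (hAM : ∀ j, A j ∈ M)
    (hM : ∀ w ∈ M, ∃ u, w - x • u ∈ Submodule.span R (Set.range A)) (Q : Ideal R)
    (hQ : ∀ (w : Fin r → Fin r → R) (j : Fin r), w j ∈ colonSub M x →
      (∀ i, i ≠ j → w i ∈ M) → colDet w ∈ Q) :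
    maxMinors M ≤ Ideal.span {colDet A} ⊔ Ideal.span {x} * Q := by
  classical
  have hspan : Submodule.span R (Set.range A) ≤ M :=
    Submodule.span_le.mpr (Set.range_subset_iff.mpr hAM)
  have key : ∀ (S : Finset (Fin r)) (w : Fin r → Fin r → R), (∀ j, w j ∈ M) →
      (∀ j, j ∉ S → w j ∈ Submodule.span R (Set.range A)) →
      colDet w ∈ Ideal.span {colDet A} ⊔ Ideal.span {x} * Q := by
    intro S
    induction S using Finset.induction_on with
    | empty =>
      intro w _ hw
      exact Ideal.mem_sup_left (colDet_mem_span_of_mem_span A w fun j => hw j (by simp))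
    | insert j S hj ih =>
      intro w hwM hw
      obtain ⟨u, hu⟩ := hM (w j) (hwM j)
      have hxu : x • u ∈ M := by
        have := M.sub_mem (hwM j) (hspan hu)
        simpa using this
      have e : colDet w = colDet (Function.update w j (w j - x • u)) +
          x * colDet (Function.update w j u) := by
        rw [← colDet_update_smul, ← colDet_update_add]
        simp
      rw [e]
      refine Ideal.add_mem _ (ih _ ?_ ?_) (Ideal.mem_sup_right
        (Ideal.mul_mem_mul (Ideal.mem_span_singleton_self x) (hQ _ j ?_ ?_)))
      · intro i
        by_cases h : i = j
        · subst h; simpa using hspan hu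
        · simpa [h] using hwM i
      · intro i hi
        by_cases h : i = j
        · subst h; simpa using hu
        · simpa [h] using hw i (by simp [h, hi])
      · simpa [mem_colonSub] using hxu
      · intro i h
        simpa [h] using hwM i
  refine Ideal.span_le.mpr ?_
  rintro _ ⟨w, hw, rfl⟩
  exact key Finset.univ w hw (by simp)

lemma maxMinors_le_span_sup {M : Submodule R (Fin r → R)} {x : R} {A : Fin r → Fin r → R}
    (hAM : ∀ j, A j ∈ M)
    (hM : ∀ w ∈ M, ∃ u, w - x • u ∈ Submodule.span R (Set.range A)) :
    maxMinors M ≤ Ideal.span {colDet A} ⊔ Ideal.span {x} := by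
  have := maxMinors_le_sup hAM hM ⊤ (fun _ _ _ _ => trivial)
  rwa [Ideal.mul_top] at this

/-- If `M :_F x ⊆ M :_F y` and the columns `A` generate `M` modulo `x F`, then
`I(M) : x` is contained in both `I(M :_F x)` and `I(M) : y`. -/
lemma mem_of_mul_mem_maxMinors [IsDomain R] {M : Submodule R (Fin r → R)} {x y : R}
    (hx : Prime x) (hc : ∀ v, x • v ∈ M → y • v ∈ M) {A : Fin r → Fin r → R}
    (hAM : ∀ j, A j ∈ M)
    (hM : ∀ w ∈ M, ∃ u, w - x • u ∈ Submodule.span R (Set.range A))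
    (hA : ¬ x ∣ colDet A) {a : R} (ha : x * a ∈ maxMinors M) :
    a ∈ maxMinors (colonSub M x) ∧ y * a ∈ maxMinors M := by
  have hd : colDet A ∈ maxMinors M := colDet_mem_maxMinors hAM
  have hle := maxMinors_mono (le_colonSub M x)
  let Q : Ideal R := maxMinors (colonSub M x) ⊓
    Submodule.comap (LinearMap.lsmul R R y) (maxMinors M)
  have hQ := maxMinors_le_sup hAM hM Q (by
    intro w j hj hw
    refine ⟨colDet_mem_maxMinors fun i => ?_, ?_⟩
    · by_cases h : i = j
      · subst h; exact hj
      · exact le_colonSub M x (hw i h)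
    · change y * colDet w ∈ maxMinors M
      have := colDet_update_smul w j y (w j)
      rw [Function.update_eq_self] at this
      rw [← this]
      refine colDet_mem_maxMinors fun i => ?_
      by_cases h : i = j
      · subst h; simpa using hc _ hj
      · simpa [h] using hw i h)
  obtain ⟨s, hs, t, ht, hst⟩ := Submodule.mem_sup.mp (hQ ha)
  obtain ⟨c, rfl⟩ := Ideal.mem_span_singleton'.mp hs
  obtain ⟨q, hq, rfl⟩ := Ideal.mem_span_singleton_mul.mp ht
  have h1 : x ∣ c * colDet A := ⟨a - q, by rw [mul_sub, ← hst]; ring⟩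
  obtain ⟨c', rfl⟩ := (hx.dvd_or_dvd h1).resolve_right hA
  have h2 : a = c' * colDet A + q := by
    refine mul_left_cancel₀ hx.ne_zero ?_
    rw [← hst]; ring
  have hmem : a ∈ Q := by
    rw [h2]
    refine Q.add_mem (Q.mul_mem_left _ ⟨hle hd, ?_⟩) hq
    exact (maxMinors M).mul_mem_left y hd
  exact ⟨hmem.1, hmem.2⟩

end Minors

section Colon

variable {R : Type*} [CommRing R]

lemma length_add_ord_le {x : R} {I K : Ideal R} (d : R)
    (hK : ∀ a, x * a ∈ I → a ∈ K) (hI : I ≤ Ideal.span {d} ⊔ Ideal.span {x}) :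
    Module.length R (R ⧸ K) +
      Ring.ord (R ⧸ Ideal.span {x}) (Ideal.Quotient.mk (Ideal.span {x}) d) ≤
      Module.length R (R ⧸ I) := by
  let D := R ⧸ Ideal.span {x}
  let J : Ideal D := Ideal.span {Ideal.Quotient.mk (Ideal.span {x}) d}
  let C : Submodule R R := Submodule.comap (LinearMap.lsmul R R x) I
  have hCK : C ≤ K := fun a ha => hK a ha
  have h1 : Module.length R (R ⧸ K) ≤ Module.length R (R ⧸ C) :=
    Module.length_le_of_surjective (Submodule.factor hCK) (Submodule.factor_surjective hCK)
  let f : (R ⧸ C) →ₗ[R] R ⧸ I := Submodule.mapQ C I (LinearMap.lsmul R R x) le_rfl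
  have hf : Function.Injective f := by
    rw [← LinearMap.ker_eq_bot, Submodule.eq_bot_iff]
    intro z
    obtain ⟨a, rfl⟩ := Submodule.mkQ_surjective _ z
    intro ha
    have : x * a ∈ I := (Submodule.Quotient.mk_eq_zero I).mp ha
    exact (Submodule.Quotient.mk_eq_zero C).mpr this
  let q : R →ₗ[R] D ⧸ J := (J.mkQ.restrictScalars R) ∘ₗ Algebra.linearMap R D
  have hq : Function.Surjective q :=
    (Submodule.mkQ_surjective J).comp Ideal.Quotient.mk_surjective
  have hqz : ∀ a, q a = 0 ↔ Ideal.Quotient.mk (Ideal.span {x}) a ∈ J := fun a =>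
    Submodule.Quotient.mk_eq_zero J
  have hqx : q x = 0 := by
    rw [hqz, Ideal.Quotient.eq_zero_iff_mem.mpr (Ideal.mem_span_singleton_self x)]
    exact J.zero_mem
  have hqd : q d = 0 := by
    rw [hqz]
    exact Ideal.mem_span_singleton_self _
  have hqI : I ≤ LinearMap.ker q := by
    refine hI.trans (sup_le ?_ ?_) <;>
    · refine (Ideal.span_singleton_le_iff_mem _).mpr ?_
      assumption
  let g : (R ⧸ I) →ₗ[R] D ⧸ J := Submodule.liftQ I q hqI
  have hg : Function.Surjective g := by
    intro z
    obtain ⟨a, rfl⟩ := hq z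
    exact ⟨Submodule.Quotient.mk a, rfl⟩
  have h2 := Module.length_add_le_of_comp_eq_zero f g hf hg (by
    ext
    change q (x * 1) = 0
    rw [mul_one, hqx])
  have h3 : Module.length R (D ⧸ J) = Module.length D (D ⧸ J) :=
    Module.length_eq_of_surjective Ideal.Quotient.mk_surjective
  rw [h3] at h2
  exact (add_le_add h1 le_rfl).trans h2

variable {r : ℕ}

/-- Reduction modulo `x` on free modules. -/
def quotPi (x : R) (r : ℕ) :
    (Fin r → R) →ₛₗ[Ideal.Quotient.mk (Ideal.span {x})] (Fin r → R ⧸ Ideal.span {x}) where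
  toFun v i := Ideal.Quotient.mk _ (v i)
  map_add' _ _ := rfl
  map_smul' _ _ := rfl

lemma quotPi_eq_zero {x : R} {v : Fin r → R} (h : quotPi x r v = 0) : ∃ u, v = x • u := by
  have : ∀ i, ∃ c, v i = x * c := fun i => by
    have hi : Ideal.Quotient.mk (Ideal.span {x}) (v i) = 0 := congrFun h i
    rw [Ideal.Quotient.eq_zero_iff_mem] at hi
    exact Ideal.mem_span_singleton.mp hi
  choose u hu using this
  exact ⟨u, funext hu⟩

lemma quotPi_surjective (x : R) : Function.Surjective (quotPi x r) := by
  intro v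
  choose u hu using fun i => Ideal.Quotient.mk_surjective (v i)
  exact ⟨u, funext hu⟩

lemma mk_colDet (x : R) (A : Fin r → Fin r → R) :
    Ideal.Quotient.mk (Ideal.span {x}) (colDet A) = colDet fun j => quotPi x r (A j) := by
  rw [colDet, RingHom.map_det]
  rfl

/-- Generators of `M` modulo `x F`, whose determinant computes the colength of `M + x F`. -/
lemma exists_columns {x : R} (hx : Prime x) [IsDomain (R ⧸ Ideal.span {x})]
    [IsPrincipalIdealRing (R ⧸ Ideal.span {x})] {M : Submodule R (Fin r → R)} {e : R}
    (he : ¬ x ∣ e) (hM : ∀ v, e • v ∈ M) :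
    ∃ A : Fin r → Fin r → R, (∀ j, A j ∈ M) ∧
      (∀ w ∈ M, ∃ u, w - x • u ∈ Submodule.span R (Set.range A)) ∧ ¬ x ∣ colDet A ∧
      Module.length R ((Fin r → R) ⧸ M) ≤ Module.length R ((Fin r → R) ⧸ colonSub M x) +
        Ring.ord (R ⧸ Ideal.span {x}) (Ideal.Quotient.mk (Ideal.span {x}) (colDet A)) := by
  let D := R ⧸ Ideal.span {x}
  let π : R →+* D := Ideal.Quotient.mk (Ideal.span {x})
  have hπ : Function.Surjective π := Ideal.Quotient.mk_surjective
  have : RingHomSurjective (Ideal.Quotient.mk (Ideal.span {x})) := ⟨hπ⟩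
  let L : Submodule D (Fin r → D) := M.map (quotPi x r)
  have he' : π e ≠ 0 := by
    rw [Ne, Ideal.Quotient.eq_zero_iff_mem, Ideal.mem_span_singleton]
    exact he
  obtain ⟨B, hB, hlen⟩ := exists_columns_length_eq_ord L (π e) he' (by
    intro v
    obtain ⟨u, rfl⟩ := quotPi_surjective x v
    exact ⟨e • u, hM u, (quotPi x r).map_smulₛₗ e u⟩)
  have hBL : ∀ j, B j ∈ L := fun j => hB ▸ Submodule.subset_span ⟨j, rfl⟩
  choose A hAM hAB using hBL
  have hAB' : quotPi x r ∘ A = B := funext hAB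
  have hgen : ∀ w ∈ M, ∃ u, w - x • u ∈ Submodule.span R (Set.range A) := by
    intro w hw
    have h1 : quotPi x r w ∈ (Submodule.span R (Set.range A)).map (quotPi x r) := by
      rw [Submodule.map_span, ← Set.range_comp, hAB', ← hB]
      exact ⟨w, hw, rfl⟩
    obtain ⟨s, hs, hsw⟩ := h1
    obtain ⟨u, hu⟩ := quotPi_eq_zero (v := w - s) (by rw [map_sub, hsw, sub_self])
    refine ⟨u, ?_⟩
    rw [← hu, sub_sub_cancel]
    exact hs
  have hdet : π (colDet A) = colDet B := by
    rw [← hAB']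
    exact mk_colDet x A
  refine ⟨A, hAM, hgen, ?_, ?_⟩
  · intro hdvd
    have h1 := maxMinors_le_span_sup hAM hgen (pow_mem_maxMinors hM)
    have h2 : Ideal.span {colDet A} ⊔ Ideal.span {x} ≤ Ideal.span {x} :=
      sup_le (Ideal.span_singleton_le_span_singleton.mpr hdvd) le_rfl
    exact he (hx.dvd_of_dvd_pow (Ideal.mem_span_singleton.mp (h2 h1)))
  · let C := colonSub M x
    let f : ((Fin r → R) ⧸ C) →ₗ[R] (Fin r → R) ⧸ M :=
      Submodule.mapQ C M (LinearMap.lsmul R (Fin r → R) x) le_rfl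
    let q : (Fin r → R) →ₗ[R] (Fin r → D) ⧸ L :=
      (L.mkQ.restrictScalars R) ∘ₗ (Algebra.linearMap R D).compLeft (Fin r)
    have hqz : ∀ v, q v = 0 ↔ quotPi x r v ∈ L := fun v => Submodule.Quotient.mk_eq_zero L
    have hqM : M ≤ LinearMap.ker q := fun w hw => (hqz w).mpr ⟨w, hw, rfl⟩
    let g : ((Fin r → R) ⧸ M) →ₗ[R] (Fin r → D) ⧸ L := Submodule.liftQ M q hqM
    have hex : Function.Exact f g := by
      intro z
      obtain ⟨v, rfl⟩ := Submodule.mkQ_surjective _ z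
      constructor
      · intro hv
        obtain ⟨w, hw, hwv⟩ := (hqz v).mp hv
        obtain ⟨u, hu⟩ := quotPi_eq_zero (v := v - w) (by rw [map_sub, hwv, sub_self])
        refine ⟨Submodule.Quotient.mk u, ?_⟩
        change Submodule.Quotient.mk (x • u) = Submodule.Quotient.mk v
        rw [← hu, Submodule.Quotient.eq]
        simpa using hw
      · rintro ⟨y, hy⟩
        obtain ⟨u, rfl⟩ := Submodule.mkQ_surjective _ y
        rw [← hy]
        change q (x • u) = 0
        rw [hqz]
        have : quotPi x r (x • u) = 0 := by
          rw [(quotPi x r).map_smulₛₗ,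
            Ideal.Quotient.eq_zero_iff_mem.mpr (Ideal.mem_span_singleton_self x), zero_smul]
        rw [this]
        exact L.zero_mem
    have h1 := Module.length_le_add_of_exact f g hex
    have h3 : Module.length R ((Fin r → D) ⧸ L) = Module.length D ((Fin r → D) ⧸ L) :=
      Module.length_eq_of_surjective hπ
    rw [h3, hlen, ← hdet] at h1
    exact h1

end Colon

section Split

variable {R : Type*} [CommRing R] {r : ℕ}

/-- The inclusion of free modules which inserts a zero coordinate at `i`. -/
def insertZero (R : Type*) [CommRing R] {r : ℕ} (i : Fin (r + 1)) :
    (Fin r → R) →ₗ[R] (Fin (r + 1) → R) where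
  toFun u := i.insertNth (α := fun _ => R) 0 u
  map_add' u v := by
    ext k
    refine Fin.succAboveCases i ?_ (fun j => ?_) k <;> simp
  map_smul' c u := by
    ext k
    refine Fin.succAboveCases i ?_ (fun j => ?_) k <;> simp

@[simp]
lemma insertZero_apply_same (i : Fin (r + 1)) (u : Fin r → R) : insertZero R i u i = 0 := by
  simp [insertZero]

@[simp]
lemma insertZero_apply_succAbove (i : Fin (r + 1)) (u : Fin r → R) (j : Fin r) :
    insertZero R i u (i.succAbove j) = u j := by
  simp [insertZero]

lemma exists_eq_smul_add_insertZero {i : Fin (r + 1)} {v : Fin (r + 1) → R} {e : R}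
    (he : e * v i = 1) (w : Fin (r + 1) → R) :
    w = (w i * e) • v +
      insertZero R i fun k => w (i.succAbove k) - w i * e * v (i.succAbove k) := by
  ext k
  refine Fin.succAboveCases i ?_ (fun j => ?_) k
  · simp [mul_assoc, he]
  · simp

variable {I : Ideal R} {i : Fin (r + 1)} {v : Fin (r + 1) → R} {e : R}
  {M : Submodule R (Fin (r + 1) → R)}

lemma sub_mem_comap_insertZero (hIv : ∀ c ∈ I, c • v ∈ M) (he : e * v i = 1)
    {w : Fin (r + 1) → R} (hw : w ∈ M) (hwi : w i ∈ I) :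
    (fun k => w (i.succAbove k) - w i * e * v (i.succAbove k)) ∈
      M.comap (insertZero R i) := by
  have h := exists_eq_smul_add_insertZero he w
  rw [Submodule.mem_comap, ← sub_eq_iff_eq_add'.mpr h]
  exact M.sub_mem hw (hIv _ (I.mul_mem_right _ hwi))

lemma maxMinors_le_mul (hIv : ∀ c ∈ I, c • v ∈ M) (he : e * v i = 1)
    (hM : ∀ w ∈ M, w i ∈ I) :
    maxMinors M ≤ I * maxMinors (M.comap (insertZero R i)) := by
  refine Ideal.span_le.mpr ?_
  rintro _ ⟨w, hw, rfl⟩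
  let u : Fin (r + 1) → Fin r → R :=
    fun j k => w j (i.succAbove k) - w j i * e * v (i.succAbove k)
  let B : Matrix (Fin (r + 1)) (Fin (r + 1)) R :=
    Matrix.of fun k j => i.insertNth (α := fun _ => R) (w j i) (u j) k
  have hdet : colDet w = B.det := by
    refine Matrix.det_eq_of_forall_row_eq_smul_add_const
      (i.insertNth (α := fun _ => R) 0 fun k => e * v (i.succAbove k)) i (by simp) ?_
    intro k j
    refine Fin.succAboveCases i ?_ (fun a => ?_) k
    · simp [B]
    · simp [B, u]
      ring
  rw [SetLike.mem_coe, hdet, Matrix.det_succ_row B i]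
  refine Ideal.sum_mem _ fun j _ => ?_
  rw [mul_assoc]
  refine Ideal.mul_mem_left _ _ (Ideal.mul_mem_mul ?_ ?_)
  · simpa [B] using hM _ (hw j)
  · have : (B.submatrix i.succAbove j.succAbove).det = colDet fun b => u (j.succAbove b) := by
      rw [colDet]
      congr 1
      ext a b
      simp [B]
    rw [this]
    exact colDet_mem_maxMinors fun b => sub_mem_comap_insertZero hIv he (hw _) (hM _ (hw _))

lemma length_quotient_le_add_length (hIv : ∀ c ∈ I, c • v ∈ M) (he : e * v i = 1)
    (hM : ∀ w ∈ M, w i ∈ I) :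
    Module.length R ((Fin (r + 1) → R) ⧸ M) ≤
      Module.length R ((Fin r → R) ⧸ M.comap (insertZero R i)) + Module.length R (R ⧸ I) := by
  let f : ((Fin r → R) ⧸ M.comap (insertZero R i)) →ₗ[R] (Fin (r + 1) → R) ⧸ M :=
    Submodule.mapQ _ M (insertZero R i) le_rfl
  let g : ((Fin (r + 1) → R) ⧸ M) →ₗ[R] R ⧸ I := Submodule.mapQ M I (LinearMap.proj i) hM
  refine Module.length_le_add_of_exact f g ?_
  intro z
  obtain ⟨w, rfl⟩ := Submodule.mkQ_surjective _ z
  constructor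
  · intro hw
    have hwi : w i ∈ I := (Submodule.Quotient.mk_eq_zero I).mp hw
    refine ⟨Submodule.Quotient.mk
      fun k => w (i.succAbove k) - w i * e * v (i.succAbove k), ?_⟩
    have h := exists_eq_smul_add_insertZero he w
    refine Eq.symm ((Submodule.Quotient.eq M).mpr ?_)
    rw [sub_eq_iff_eq_add.mpr h]
    exact hIv _ (I.mul_mem_right _ hwi)
  · rintro ⟨y, hy⟩
    obtain ⟨u, rfl⟩ := Submodule.mkQ_surjective _ y
    rw [← hy]
    change Submodule.Quotient.mk (insertZero R i u i) = 0
    simp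

end Split

section Contracted

variable {R : Type*} [CommRing R]

lemma span_pair_pow_le (x y : R) (n : ℕ) :
    Ideal.span {x, y} ^ n ≤ Ideal.span {y ^ n} ⊔ Ideal.span {x} := by
  induction n with
  | zero => simp
  | succ n ih =>
    intro z hz
    rw [pow_succ] at hz
    refine Submodule.mul_induction_on hz (fun s hs t ht => ?_) fun s t hs ht => add_mem hs ht
    obtain ⟨a, ha, b, hb, rfl⟩ := Submodule.mem_sup.mp (ih hs)
    obtain ⟨a, rfl⟩ := Ideal.mem_span_singleton'.mp ha
    obtain ⟨b, rfl⟩ := Ideal.mem_span_singleton'.mp hb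
    obtain ⟨c, d, rfl⟩ := Ideal.mem_span_pair.mp ht
    refine Submodule.mem_sup.mpr ⟨a * d * y ^ (n + 1),
      Ideal.mul_mem_left _ _ (Ideal.mem_span_singleton_self _),
      (a * y ^ n * c + b * (c * x + d * y)) * x,
      Ideal.mul_mem_left _ _ (Ideal.mem_span_singleton_self _), by ring⟩

/-- If `K` is contracted and `K = (d)` modulo `x`, then `𝔪 K : x ⊆ K`. -/
lemma mem_of_mul_mem_mul [IsDomain R] {x y d : R} {K : Ideal R} (hx : Prime x) (hxy : ¬ x ∣ y)
    (hxd : ¬ x ∣ d) (hdK : d ∈ K) (hK : K ≤ Ideal.span {d} ⊔ Ideal.span {x})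
    (hc : ∀ a, x * a ∈ K → y * a ∈ K) {a : R} (ha : x * a ∈ Ideal.span {x, y} * K) : a ∈ K := by
  have hle : Ideal.span {x, y} * K ≤ Ideal.span {x} * K ⊔ Ideal.span {y * d} := by
    rw [Ideal.span_insert, Ideal.sup_mul]
    refine sup_le le_sup_left ?_
    intro z hz
    obtain ⟨k, hk, rfl⟩ := Ideal.mem_span_singleton_mul.mp hz
    obtain ⟨s, hs, t, ht, rfl⟩ := Submodule.mem_sup.mp (hK hk)
    obtain ⟨c, rfl⟩ := Ideal.mem_span_singleton'.mp hs
    obtain ⟨b, rfl⟩ := Ideal.mem_span_singleton.mp ht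
    have hb : y * b ∈ K := hc b (by simpa using K.sub_mem hk (K.mul_mem_left c hdK))
    have e : y * (c * d + x * b) = x * (y * b) + c * (y * d) := by ring
    rw [e]
    exact Ideal.add_mem _
      (Ideal.mem_sup_left (Ideal.mul_mem_mul (Ideal.mem_span_singleton_self x) hb))
      (Ideal.mem_sup_right (Ideal.mul_mem_left _ _ (Ideal.mem_span_singleton_self _)))
  obtain ⟨s, hs, t, ht, hst⟩ := Submodule.mem_sup.mp (hle ha)
  obtain ⟨k, hk, rfl⟩ := Ideal.mem_span_singleton_mul.mp hs
  obtain ⟨c, rfl⟩ := Ideal.mem_span_singleton'.mp ht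
  have h1 : x ∣ c * (y * d) := ⟨a - k, by rw [mul_sub, ← hst]; ring⟩
  have h2 : ¬ x ∣ y * d := fun h => (hx.dvd_or_dvd h).elim hxy hxd
  obtain ⟨c', rfl⟩ := (hx.dvd_or_dvd h1).resolve_right h2
  have h3 : a = k + c' * y * d := by
    refine mul_left_cancel₀ hx.ne_zero ?_
    rw [← hst]; ring
  rw [h3]
  exact K.add_mem hk (K.mul_mem_left _ hdK)

lemma add_choose_le_length_of_contracted [IsDomain R] [IsLocalRing R] {x y : R}
    (hm : maximalIdeal R = Ideal.span {x, y}) (hx : Prime x) [IsDomain (R ⧸ Ideal.span {x})]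
    [IsPrincipalIdealRing (R ⧸ Ideal.span {x})]
    (hy : Irreducible (Ideal.Quotient.mk (Ideal.span {x}) y)) (k : ℕ) :
    ∀ (r n : ℕ) (M : Submodule R (Fin r → R)), (∀ v : Fin r → R, x ^ n • v ∈ M) →
      (∀ v : Fin r → R, y ^ k • v ∈ M) → (∀ v : Fin r → R, x • v ∈ M → y • v ∈ M) →
      (∀ w ∈ M, ∀ i, w i ∈ maximalIdeal R) →
      Module.length R ((Fin r → R) ⧸ M) + ((r * (r - 1) / 2 : ℕ) : ℕ∞) ≤
        Module.length R (R ⧸ maxMinors M) := by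
  have hxy : ¬ x ∣ y := by
    rw [← Ideal.mem_span_singleton, ← Ideal.Quotient.eq_zero_iff_mem]
    exact hy.ne_zero
  have hxyk : ¬ x ∣ y ^ k := fun h => hxy (hx.dvd_of_dvd_pow h)
  intro r
  induction r with
  | zero =>
    intro n M _ _ _ _
    simp
  | succ r ihr =>
    intro n
    induction n with
    | zero =>
      intro M hxn _ _ hMm
      refine absurd (hMm _ (hxn fun _ => 1) 0) ?_
      simp
    | succ n ihn =>
      intro M hxn hyk hc hMm
      by_cases hM1 : ∀ w ∈ colonSub M x, ∀ i, w i ∈ maximalIdeal R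
      · obtain ⟨A, hAM, hgen, hA, hlen⟩ := exists_columns hx hxyk hyk
        have h1 := ihn (colonSub M x)
          (fun v => by rw [mem_colonSub, ← mul_smul, ← pow_succ']; exact hxn v)
          (fun v => le_colonSub M x (hyk v))
          (fun v hv => by rw [mem_colonSub, smul_comm]; exact hc _ hv) hM1
        have h2 := length_add_ord_le (colDet A)
          (fun a ha => (mem_of_mul_mem_maxMinors hx hc hAM hgen hA ha).1)
          (maxMinors_le_span_sup hAM hgen)
        calc _ ≤ _ + _ := add_le_add_left hlen _
          _ = _ + _ := add_right_comm _ _ _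
          _ ≤ _ + _ := add_le_add_left h1 _
          _ ≤ _ := h2
      · push Not at hM1
        obtain ⟨v, hv, i, hvi⟩ := hM1
        obtain ⟨e, he⟩ := (IsLocalRing.notMem_maximalIdeal.mp hvi).exists_left_inv
        have hIv : ∀ c ∈ maximalIdeal R, c • v ∈ M := by
          intro c hcm
          rw [hm] at hcm
          obtain ⟨a, b, rfl⟩ := Ideal.mem_span_pair.mp hcm
          rw [add_smul, mul_smul, mul_smul]
          exact M.add_mem (M.smul_mem _ hv) (M.smul_mem _ (hc v hv))
        let N := M.comap (insertZero R i)
        have hNx : ∀ v : Fin r → R, x ^ (n + 1) • v ∈ N := fun v => by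
          rw [Submodule.mem_comap, map_smul]; exact hxn _
        have hNy : ∀ v : Fin r → R, y ^ k • v ∈ N := fun v => by
          rw [Submodule.mem_comap, map_smul]; exact hyk _
        have hNc : ∀ v : Fin r → R, x • v ∈ N → y • v ∈ N := fun v hv => by
          rw [Submodule.mem_comap, map_smul] at hv ⊢; exact hc _ hv
        have hNm : ∀ w ∈ N, ∀ j, w j ∈ maximalIdeal R := fun w hw j => by
          have := hMm _ hw (i.succAbove j)
          rwa [insertZero_apply_succAbove] at this
        have h1 := ihr (n + 1) N hNx hNy hNc hNm
        obtain ⟨A, hAN, hgen, hA, -⟩ := exists_columns hx hxyk hNy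
        have hKd := maxMinors_le_span_sup hAN hgen
        have hpow : maximalIdeal R * maxMinors N ≤
            Ideal.span {y ^ (r + 1)} ⊔ Ideal.span {x} := by
          refine le_trans ?_ (span_pair_pow_le x y (r + 1))
          rw [← hm, pow_succ']
          exact Ideal.mul_mono_right (maxMinors_le_pow hNm)
        have h2 := length_add_ord_le (y ^ (r + 1)) (K := maxMinors N)
          (fun a ha => mem_of_mul_mem_mul hx hxy hA (colDet_mem_maxMinors hAN) hKd
            (fun b hb => (mem_of_mul_mem_maxMinors hx hNc hAN hgen hA hb).2)
            (by rwa [hm] at ha)) hpow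
        have hord : Ring.ord (R ⧸ Ideal.span {x})
            (Ideal.Quotient.mk (Ideal.span {x}) (y ^ (r + 1))) = ((r + 1 : ℕ) : ℕ∞) := by
          rw [map_pow, Ring.ord_pow (mem_nonZeroDivisors_of_ne_zero hy.ne_zero),
            Ring.ord_of_irreducible hy]
          simp
        rw [hord] at h2
        have h3 : Module.length R (R ⧸ maximalIdeal R * maxMinors N) ≤
            Module.length R (R ⧸ maxMinors M) := by
          have := maxMinors_le_mul hIv he (fun w hw => hMm w hw i)
          exact Module.length_le_of_surjective (Submodule.factor this)
            (Submodule.factor_surjective this)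
        have h4 := length_quotient_le_add_length hIv he (fun w hw => hMm w hw i)
        have h5 : Module.length R (R ⧸ maximalIdeal R) = 1 := by
          have : IsSimpleModule R (R ⧸ maximalIdeal R) :=
            isSimpleModule_iff_isCoatom.mpr (maximalIdeal.isMaximal R).out
          exact Module.length_eq_one R _
        rw [h5] at h4
        have hnum : ((r + 1) * (r + 1 - 1) / 2 : ℕ) = r * (r - 1) / 2 + r := by
          rw [← Nat.triangle_succ]
        calc _ ≤ (Module.length R ((Fin r → R) ⧸ N) + 1) +
              (((r + 1) * (r + 1 - 1) / 2 : ℕ) : ℕ∞) := add_le_add_left h4 _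
          _ = (Module.length R ((Fin r → R) ⧸ N) + ((r * (r - 1) / 2 : ℕ) : ℕ∞)) +
              ((r + 1 : ℕ) : ℕ∞) := by
            rw [hnum]
            push_cast
            abel
          _ ≤ _ + _ := add_le_add_left h1 _
          _ ≤ _ := h2.trans h3

end Contracted

section Regular

lemma exists_isPrime_lt_lt {R : Type*} [CommRing R] [IsLocalRing R]
    (hdim : ringKrullDim R = 2) :
    ∃ Q P : Ideal R, Q.IsPrime ∧ P.IsPrime ∧ Q < P ∧ P < maximalIdeal R := by
  obtain ⟨l, hl⟩ := Order.le_krullDim_iff.mp (show ((2 : ℕ) : WithBot ℕ∞) ≤ _ from hdim.ge)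
  have h01 : l ⟨0, by omega⟩ < l ⟨1, by omega⟩ := l.strictMono (Fin.mk_lt_mk.mpr one_pos)
  have h12 : l ⟨1, by omega⟩ < l ⟨2, by omega⟩ := l.strictMono (Fin.mk_lt_mk.mpr one_lt_two)
  exact ⟨_, _, (l ⟨0, by omega⟩).isPrime, (l ⟨1, by omega⟩).isPrime, h01,
    lt_of_lt_of_le h12 (le_maximalIdeal (l ⟨2, by omega⟩).isPrime.ne_top)⟩

variable {R : Type*} [CommRing R] [IsLocalRing R] [IsNoetherianRing R] {x y : R}

lemma span_singleton_isPrime_of_lt_of_lt (hm : maximalIdeal R = Ideal.span {x, y})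
    {Q P : Ideal R} [Q.IsPrime] [P.IsPrime] (hQP : Q < P) (hP : P < maximalIdeal R) :
    (Ideal.span {x}).IsPrime ∧ Q ≤ Ideal.span {x} ∧ y ∉ Ideal.span {x} := by
  have hxm : x ∈ maximalIdeal R := hm ▸ Ideal.subset_span (by simp)
  obtain ⟨P', hP', hle⟩ := Ideal.exists_minimalPrimes_le (I := Q ⊔ Ideal.span {x})
    (J := maximalIdeal R) (sup_le (hQP.trans hP).le ((Ideal.span_singleton_le_iff_mem _).mpr hxm))
  have hprime := hP'.isPrime
  have hxP' : x ∈ P' := hP'.le (Ideal.mem_sup_right (Ideal.mem_span_singleton_self x))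
  have hQP' : Q ≤ P' := le_sup_left.trans hP'.le
  have hne : P' ≠ maximalIdeal R := by
    rintro rfl
    have hspan : Ideal.span (insert x (Q : Set R)) = Q ⊔ Ideal.span {x} := by
      rw [Ideal.span_insert, Ideal.span_eq, sup_comm]
    rw [← hspan] at hP'
    have := Ideal.mem_minimalPrimes_span_of_mem_minimalPrimes_span_insert hP x Q hP' Q hQP.le
      fun a ha => Ideal.le_radical (Ideal.subset_span (Set.mem_insert_of_mem _ ha))
    rw [Ideal.span_eq] at this
    exact hQP.not_ge (this.2 ⟨inferInstance, le_rfl⟩ hQP.le)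
  have hyP' : y ∉ P' := by
    refine fun h => hne (le_antisymm hle ?_)
    rw [hm, Ideal.span_le]
    rintro a (rfl | rfl)
    exacts [hxP', h]
  have hle' : P' ≤ Ideal.span {x} := by
    refine Submodule.le_of_le_smul_of_le_jacobson_bot (I := maximalIdeal R)
      (IsNoetherian.noetherian _) (maximalIdeal_le_jacobson _) fun p hp => ?_
    have hp' := hle hp
    rw [hm] at hp'
    obtain ⟨a, b, rfl⟩ := Ideal.mem_span_pair.mp hp'
    have hb : b * y ∈ P' := by simpa using P'.sub_mem hp (P'.mul_mem_left a hxP')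
    refine Submodule.add_mem_sup (Ideal.mul_mem_left _ _ (Ideal.mem_span_singleton_self x)) ?_
    rw [mul_comm, ← smul_eq_mul]
    exact Submodule.smul_mem_smul (hm ▸ Ideal.subset_span (by simp))
      ((hprime.mem_or_mem hb).resolve_right hyP')
  have heq : P' = Ideal.span {x} :=
    le_antisymm hle' ((Ideal.span_singleton_le_iff_mem _).mpr hxP')
  exact heq ▸ ⟨hprime, hQP', hyP'⟩

lemma isDomain_of_ringKrullDim_eq_two (hm : maximalIdeal R = Ideal.span {x, y})
    (hdim : ringKrullDim R = 2) : IsDomain R := by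
  obtain ⟨Q, P, hQ, hP, hQP, hPm⟩ := exists_isPrime_lt_lt hdim
  obtain ⟨-, hQx, -⟩ := span_singleton_isPrime_of_lt_of_lt hm hQP hPm
  obtain ⟨-, hQy, hxy⟩ :=
    span_singleton_isPrime_of_lt_of_lt (x := y) (y := x) (by rw [hm, Set.pair_comm]) hQP hPm
  have hxQ : x ∉ Q := fun h => hxy (hQy h)
  have hbot : Q = ⊥ := by
    refine Submodule.eq_bot_of_le_smul_of_le_jacobson_bot (maximalIdeal R) Q
      (IsNoetherian.noetherian _) (fun q hq => ?_) (maximalIdeal_le_jacobson _)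
    obtain ⟨a, rfl⟩ := Ideal.mem_span_singleton.mp (hQx hq)
    exact Submodule.smul_mem_smul (hm ▸ Ideal.subset_span (by simp))
      ((hQ.mem_or_mem hq).resolve_left hxQ)
  rw [hbot] at hQ
  exact IsDomain.of_bot_isPrime R

lemma quotient_span_singleton_regular (hm : maximalIdeal R = Ideal.span {x, y})
    (hdim : ringKrullDim R = 2) :
    IsDomain (R ⧸ Ideal.span {x}) ∧ IsPrincipalIdealRing (R ⧸ Ideal.span {x}) ∧
      Irreducible (Ideal.Quotient.mk (Ideal.span {x}) y) := by
  obtain ⟨Q, P, hQ, hP, hQP, hPm⟩ := exists_isPrime_lt_lt hdim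
  obtain ⟨hx, -, hyx⟩ := span_singleton_isPrime_of_lt_of_lt hm hQP hPm
  have hD : IsDomain (R ⧸ Ideal.span {x}) := Ideal.Quotient.isDomain _
  have hsurj : Function.Surjective (Ideal.Quotient.mk (Ideal.span {x})) :=
    Ideal.Quotient.mk_surjective
  have hloc : IsLocalRing (R ⧸ Ideal.span {x}) := IsLocalRing.of_surjective' _ hsurj
  have hmax : maximalIdeal (R ⧸ Ideal.span {x}) =
      Ideal.span {Ideal.Quotient.mk (Ideal.span {x}) y} := by
    have hlh : IsLocalHom (Ideal.Quotient.mk (Ideal.span {x})) :=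
      IsLocalHom.of_surjective _ hsurj
    have h0 : Ideal.Quotient.mk (Ideal.span {x}) x = 0 :=
      Ideal.Quotient.eq_zero_iff_mem.mpr (Ideal.mem_span_singleton_self x)
    rw [← IsLocalRing.map_maximalIdeal_of_surjective _ hsurj, hm, Ideal.map_span, Set.image_pair,
      h0, Ideal.span_insert_zero]
  refine ⟨hD, ?_, ?_⟩
  · have hprin : (maximalIdeal (R ⧸ Ideal.span {x})).IsPrincipal := ⟨_, hmax⟩
    exact ((tfae_of_isNoetherianRing_of_isLocalRing_of_isDomain _).out 4 0).mp hprin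
  · refine IsDiscreteValuationRing.irreducible_of_span_eq_maximalIdeal _ ?_ hmax
    rwa [Ne, Ideal.Quotient.eq_zero_iff_mem]

end Regular

section Integral

variable {R : Type*} [CommRing R] {r : ℕ} {M : Submodule R (Fin r → R)}

lemma colDet_update_mem_mul {J : Ideal R} {w : Fin r → Fin r → R} {j₀ : Fin r}
    (hw : ∀ j, j ≠ j₀ → w j ∈ M) {v : Fin r → R} (hv : v ∈ J • M) :
    colDet (Function.update w j₀ v) ∈ J * maxMinors M := by
  refine Submodule.smul_induction_on hv (fun a ha m hm => ?_) fun u v hu hv => ?_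
  · rw [colDet_update_smul]
    refine Ideal.mul_mem_mul ha (colDet_mem_maxMinors fun j => ?_)
    by_cases hj : j = j₀
    · subst hj
      simpa using hm
    · simpa [hj] using hw j hj
  · rw [colDet_update_add]
    exact add_mem hu hv

lemma memIntClosure_of_mul_mem_s5 [IsDomain R] [IsNoetherianRing R] {I J : Ideal R} (hJ : J ≠ ⊥)
    {z : R} (h : ∀ a ∈ J, z * a ∈ I * J) : MemIntClosure I z := by
  obtain ⟨p, hp, -, hpI, hpz⟩ :=
    LinearMap.exists_monic_and_natDegree_eq_and_coeff_mem_pow_and_aeval_eq_zero R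
      (algebraMap R (Module.End R J) z) I (by
        rintro _ ⟨a, rfl⟩
        rw [Submodule.mem_smul_top_iff]
        exact h _ a.2)
  have hz : p.eval z = 0 := by
    obtain ⟨a, ha, ha0⟩ := Submodule.exists_mem_ne_zero_of_ne_bot hJ
    rw [Polynomial.aeval_algebraMap_apply_eq_algebraMap_eval] at hpz
    have := congrArg (Subtype.val) (LinearMap.congr_fun hpz ⟨a, ha⟩)
    exact (mul_eq_zero.mp this).resolve_right ha0
  refine ⟨p.natDegree, Nat.pos_of_ne_zero fun h0 => ?_, fun i => p.coeff (p.natDegree - i),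
    fun i hi => ?_, ?_⟩
  · rw [hp.natDegree_eq_zero.mp h0] at hz
    simp at hz
  · have := hpI (p.natDegree - i)
    rwa [Nat.sub_sub_self (Finset.mem_Icc.mp hi).2] at this
  · have hIcc : Finset.Icc 1 p.natDegree = Finset.Ico 1 (p.natDegree + 1) := by
      ext
      simp
    rw [← hz, Polynomial.eval_eq_sum_range, ← Finset.sum_range_reflect, Finset.range_eq_Ico,
      Finset.sum_eq_sum_Ico_succ_bot (Nat.succ_pos _), hIcc]
    simp [hp.coeff_natDegree]

lemma integralOverMod_of_smul_mem [IsDomain R] [IsNoetherianRing R] {J : Ideal R} (hJ : J ≠ ⊥)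
    {v : Fin r → R} (h : ∀ a ∈ J, a • v ∈ J • M) : IntegralOverMod M v := by
  rintro w j₀ rfl hw
  refine memIntClosure_of_mul_mem_s5 hJ fun a ha => ?_
  have := colDet_update_mem_mul hw (h a ha)
  rwa [colDet_update_smul, Function.update_eq_self, mul_comm a, mul_comm J] at this

end Integral

section Recurrence

variable {R N : Type*} [CommRing R] [AddCommGroup N] [Module R N] {M : Submodule R N}
  {x y : R} {g : ℕ → N} {n : ℕ}

lemma pow_mul_pow_smul_mem {I : Ideal R} (hx : x ∈ I) (hy : y ∈ I) (p q : ℕ) {m : N}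
    (hm : m ∈ M) : (x ^ p * y ^ q) • m ∈ I ^ (p + q) • M := by
  rw [pow_add]
  exact Submodule.smul_mem_smul
    (Ideal.mul_mem_mul (Ideal.pow_mem_pow hx p) (Ideal.pow_mem_pow hy q)) hm

lemma monomial_smul_mem_of_lt (h0 : x • g 0 ∈ M) (hg : ∀ i, x • g (i + 1) + y • g i ∈ M)
    {I : Ideal R} (hx : x ∈ I) (hy : y ∈ I) (i p q : ℕ) (hp : i ≤ p) :
    (x ^ (p + 1) * y ^ q) • g i ∈ I ^ (p + q) • M := by
  induction i generalizing p q with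
  | zero =>
    have := pow_mul_pow_smul_mem hx hy p q h0
    rwa [smul_smul, show x ^ p * y ^ q * x = x ^ (p + 1) * y ^ q by ring] at this
  | succ i ih =>
    obtain ⟨p, rfl⟩ : ∃ p', p = p' + 1 := ⟨p - 1, by omega⟩
    have h1 := pow_mul_pow_smul_mem hx hy (p + 1) q (hg i)
    have h2 := ih p (q + 1) (by omega)
    rw [show p + (q + 1) = p + 1 + q by omega] at h2
    convert! Submodule.sub_mem _ h1 h2 using 1
    module

lemma monomial_smul_mem_of_le (hg : ∀ i, x • g (i + 1) + y • g i ∈ M)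
    (hn : ∀ i, n ≤ i → g i = 0) {I : Ideal R} (hx : x ∈ I) (hy : y ∈ I) (i p q : ℕ)
    (hq : n ≤ i + q + 1) :
    (x ^ p * y ^ (q + 1)) • g i ∈ I ^ (p + q) • M := by
  induction q generalizing i p with
  | zero =>
    have := pow_mul_pow_smul_mem hx hy p 0 (hg i)
    rw [hn (i + 1) hq, smul_zero, zero_add, smul_smul] at this
    simpa using this
  | succ q ih =>
    have h1 := pow_mul_pow_smul_mem hx hy p (q + 1) (hg i)
    have h2 := ih (i + 1) (p + 1) (by omega)
    rw [show p + 1 + q = p + (q + 1) by omega] at h2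
    convert! Submodule.sub_mem _ h1 h2 using 1
    module

lemma monomial_smul_mem (h0 : x • g 0 ∈ M) (hg : ∀ i, x • g (i + 1) + y • g i ∈ M)
    (hn : ∀ i, n ≤ i → g i = 0) {I : Ideal R} (hx : x ∈ I) (hy : y ∈ I) (i p q : ℕ)
    (hpq : n ≤ p + q) :
    (x ^ p * y ^ q) • y • g i ∈ I ^ (p + q) • M := by
  rw [smul_smul, mul_assoc, ← pow_succ]
  by_cases hq : n ≤ i + q + 1
  · exact monomial_smul_mem_of_le hg hn hx hy i p q hq
  · obtain ⟨p, rfl⟩ : ∃ p', p = p' + 1 := ⟨p - 1, by omega⟩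
    have := monomial_smul_mem_of_lt h0 hg hx hy i p (q + 1) (by omega)
    rwa [show p + (q + 1) = p + 1 + q by omega] at this

lemma smul_mem_of_mem_span_pair_pow {v : N} {I : Ideal R} (hI : I = Ideal.span {x, y})
    (P : Submodule R N) (m p q : ℕ)
    (h : ∀ s t, s + t = p + q + m → (x ^ s * y ^ t) • v ∈ P) {a : R} (ha : a ∈ I ^ m) :
    (a * (x ^ p * y ^ q)) • v ∈ P := by
  induction m generalizing p q a with
  | zero =>
    rw [mul_smul]
    exact P.smul_mem _ (h p q rfl)
  | succ m ih =>
    rw [pow_succ] at ha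
    refine Submodule.mul_induction_on ha (fun s hs t ht => ?_) fun s t hs ht => ?_
    · rw [hI] at ht
      obtain ⟨c, d, rfl⟩ := Ideal.mem_span_pair.mp ht
      have h1 := ih (p + 1) q (fun s t hst => h s t (by omega)) hs
      have h2 := ih p (q + 1) (fun s t hst => h s t (by omega)) hs
      convert! P.add_mem (P.smul_mem c h1) (P.smul_mem d h2) using 1
      module
    · rw [add_mul, add_smul]
      exact P.add_mem hs ht

end Recurrence

section Generic

variable {R : Type*} [CommRing R] {r : ℕ} {M : Submodule R (Fin r → R)} {x y : R}

/-- If `(x + X y) g` has all coefficients in the integrally closed module `M`, then so does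
`y g`. -/
lemma smul_mem_of_recurrence [IsDomain R] [IsNoetherianRing R] (hM : ModIntClosed M)
    (hx0 : x ≠ 0) {g : ℕ → Fin r → R} {n : ℕ} (h0 : x • g 0 ∈ M)
    (hg : ∀ i, x • g (i + 1) + y • g i ∈ M) (hn : ∀ i, n ≤ i → g i = 0) (i : ℕ) :
    y • g i ∈ M := by
  have hx : x ∈ Ideal.span {x, y} := Ideal.subset_span (by simp)
  have hy : y ∈ Ideal.span {x, y} := Ideal.subset_span (by simp)
  refine hM _ (integralOverMod_of_smul_mem (J := Ideal.span {x, y} ^ n) ?_ fun a ha => ?_)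
  · exact fun h => pow_ne_zero n hx0 (by simpa [h] using Ideal.pow_mem_pow hx n)
  · have := smul_mem_of_mem_span_pair_pow (v := y • g i) rfl (Ideal.span {x, y} ^ n • M) n 0 0
      (fun s t hst => by
        have := monomial_smul_mem h0 hg hn hx hy i s t (by omega)
        rwa [show s + t = n by omega] at this) ha
    simpa using this

open Polynomial

/-- The polynomial vectors whose coefficients lie in `M`. -/
def polySub (M : Submodule R (Fin r → R)) : Submodule R[X] (Fin r → R[X]) where
  carrier := {f | ∀ k, (fun i => (f i).coeff k) ∈ M}
  add_mem' hf hg k := by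
    simpa only [Pi.add_apply, coeff_add] using! M.add_mem (hf k) (hg k)
  zero_mem' k := by
    simpa only [Pi.zero_apply, coeff_zero] using! M.zero_mem
  smul_mem' p f hf k := by
    have : (fun i => ((p • f) i).coeff k) =
        ∑ ab ∈ Finset.HasAntidiagonal.antidiagonal k, p.coeff ab.1 • fun i => (f i).coeff ab.2 := by
      ext i
      simp [coeff_mul]
    rw [this]
    exact M.sum_mem fun ab _ => M.smul_mem _ (hf ab.2)

lemma exists_forall_coeff_eq_zero (f : Fin r → R[X]) :
    ∃ n, ∀ k, n ≤ k → (fun i => (f i).coeff k) = 0 := by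
  refine ⟨Finset.univ.sup (fun i => (f i).natDegree) + 1, fun k hk => funext fun i => ?_⟩
  exact coeff_eq_zero_of_natDegree_lt
    ((Finset.le_sup (f := fun i => (f i).natDegree) (Finset.mem_univ i)).trans_lt hk)

lemma eval_mem_of_mem_polySub {f : Fin r → R[X]} (hf : f ∈ polySub M) (c : R) :
    (fun i => (f i).eval c) ∈ M := by
  have : (fun i => (f i).eval c) =
      ∑ k ∈ Finset.range (Finset.univ.sup (fun i => (f i).natDegree) + 1),
        c ^ k • fun i => (f i).coeff k := by
    ext i
    rw [eval_eq_sum_range' (Nat.lt_succ_of_le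
      (Finset.le_sup (f := fun i => (f i).natDegree) (Finset.mem_univ i)))]
    simp [mul_comm]
  rw [this]
  exact M.sum_mem fun k _ => M.smul_mem _ (hf k)

lemma C_smul_mem_polySub [IsDomain R] [IsNoetherianRing R] (hM : ModIntClosed M)
    (hx0 : x ≠ 0) {g : Fin r → R[X]} (hg : (C x + X * C y) • g ∈ polySub M) :
    C y • g ∈ polySub M := by
  obtain ⟨n, hn⟩ := exists_forall_coeff_eq_zero g
  intro k
  have := smul_mem_of_recurrence (y := y) hM hx0 (g := fun k i => (g i).coeff k) (n := n) ?_ ?_ hn k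
  · simpa [Pi.smul_def] using this
  · have := hg 0
    simpa [add_mul, mul_assoc, Pi.smul_def] using this
  · intro k
    have := hg (k + 1)
    simpa [add_mul, mul_assoc, coeff_X_mul, Pi.smul_def, Pi.add_def] using this

/-- The quotient whose zero divisors detect the bad parameters. -/
noncomputable abbrev genericSub (M : Submodule R (Fin r → R)) (x y : R) :
    Submodule R[X] (Fin r → R[X]) :=
  polySub M ⊔ LinearMap.range (LinearMap.lsmul R[X] (Fin r → R[X]) (C x + X * C y))

lemma smul_mem_of_not_zero_divisor [IsDomain R] [IsNoetherianRing R] (hM : ModIntClosed M)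
    (hx0 : x ≠ 0) {c : R}
    (hc : ∀ z : (Fin r → R[X]) ⧸ genericSub M x y, (X - C c) • z = 0 → z = 0) (a : Fin r → R)
    (ha : (x + c * y) • a ∈ M) : y • a ∈ M := by
  let a' : Fin r → R[X] := fun i => C (a i)
  have ha' : (C x + C c * C y) • a' ∈ polySub M := by
    intro k
    by_cases hk : k = 0
    · subst hk
      simpa [a', Pi.smul_def] using ha
    · simp only [a', Pi.smul_apply, smul_eq_mul, ← C_mul, ← C_add, coeff_C, if_neg hk]
      exact M.zero_mem
  have hmem : C y • a' ∈ genericSub M x y := by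
    rw [← Submodule.Quotient.mk_eq_zero]
    refine hc _ ?_
    rw [← Submodule.Quotient.mk_smul, Submodule.Quotient.mk_eq_zero]
    have : (X - C c) • C y • a' = (C x + X * C y) • a' - (C x + C c * C y) • a' := by module
    rw [this]
    exact Submodule.sub_mem _ (Submodule.mem_sup_right ⟨a', rfl⟩) (Submodule.mem_sup_left ha')
  obtain ⟨m, hm, _, ⟨b, rfl⟩, hab⟩ := Submodule.mem_sup.mp hmem
  change m + (C x + X * C y) • b = C y • a' at hab
  have hg : (C x + X * C y) • (a' - (X - C c) • b) ∈ polySub M := by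
    have : (C x + X * C y) • (a' - (X - C c) • b) =
        (C x + C c * C y) • a' + (X - C c) • m := by
      rw [smul_sub, smul_comm _ (X - C c), ← sub_eq_iff_eq_add'.mpr hab.symm]
      module
    rw [this]
    exact Submodule.add_mem _ ha' (Submodule.smul_mem _ _ hm)
  have := eval_mem_of_mem_polySub (C_smul_mem_polySub hM hx0 hg) c
  simpa [a', Pi.smul_def] using this

lemma exists_contracted [IsDomain R] [IsNoetherianRing R] [IsLocalRing R]
    [Infinite (ResidueField R)] (hM : ModIntClosed M) (hx0 : x ≠ 0) (y : R) :
    ∃ c : R, ∀ a : Fin r → R, (x + c * y) • a ∈ M → y • a ∈ M := by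
  by_contra! hcon
  have hass : ∀ c : R, ∃ p ∈ associatedPrimes R[X] ((Fin r → R[X]) ⧸ genericSub M x y),
      X - C c ∈ p := by
    intro c
    obtain ⟨a, ha, ha'⟩ := hcon c
    have : X - C c ∈ {s : R[X] | ∃ z : (Fin r → R[X]) ⧸ genericSub M x y, z ≠ 0 ∧ s • z = 0} := by
      by_contra hc
      refine ha' (smul_mem_of_not_zero_divisor hM hx0 (fun z hz => ?_) a ha)
      by_contra hz0
      exact hc ⟨z, hz0, hz⟩
    rw [← biUnion_associatedPrimes_eq_zero_divisors] at this
    simpa using this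
  choose p hp hpc using hass
  let s : ResidueField R → R := Function.surjInv residue_surjective
  have hinj : Function.Injective fun t => (⟨p (s t), hp (s t)⟩ :
      associatedPrimes R[X] ((Fin r → R[X]) ⧸ genericSub M x y)) := by
    intro t u htu
    by_contra hne
    have hpeq : p (s t) = p (s u) := congrArg Subtype.val htu
    have hmem : C (s t - s u) ∈ p (s u) := by
      have := (p (s u)).sub_mem (hpc (s u)) (hpeq ▸ hpc (s t))
      rwa [sub_sub_sub_cancel_left, ← C_sub] at this
    have hunit : IsUnit (s t - s u) := by
      rw [← residue_ne_zero_iff_isUnit, map_sub, sub_ne_zero]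
      simpa only [s, Function.surjInv_eq] using hne
    exact (hp (s u)).isPrime.ne_top (Ideal.eq_top_of_isUnit_mem _ hmem (hunit.map C))
  have hfin := (associatedPrimes.finite R[X] ((Fin r → R[X]) ⧸ genericSub M x y)).to_subtype
  exact not_finite_iff_infinite.mpr ‹Infinite (ResidueField R)› (Finite.of_injective _ hinj)

end Generic

section Final

variable {R : Type*} [CommRing R] [IsLocalRing R] {r : ℕ} {M : Submodule R (Fin r → R)}

lemma exists_pow_smul_eq_zero {N : Type*} [AddCommGroup N] [Module R N]
    (hN : IsFiniteLength R N) {x : R} (hx : x ∈ maximalIdeal R) : ∃ n, ∀ v : N, x ^ n • v = 0 := by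
  obtain ⟨hnoeth, hart⟩ := isFiniteLength_iff_isNoetherian_isArtinian.mp hN
  obtain ⟨n, hn⟩ := IsArtinian.monotone_stabilizes
    ⟨fun n => OrderDual.toDual (LinearMap.range (LinearMap.lsmul R N (x ^ n))),
      monotone_nat_of_le_succ fun n => by
        rintro _ ⟨v, rfl⟩
        exact ⟨x • v, by rw [LinearMap.lsmul_apply, LinearMap.lsmul_apply, pow_succ, mul_smul]⟩⟩
  have heq : LinearMap.range (LinearMap.lsmul R N (x ^ n)) =
      LinearMap.range (LinearMap.lsmul R N (x ^ (n + 1))) := hn (n + 1) n.le_succ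
  have hbot : LinearMap.range (LinearMap.lsmul R N (x ^ n)) = ⊥ := by
    refine Submodule.eq_bot_of_le_smul_of_le_jacobson_bot (maximalIdeal R) _
      (IsNoetherian.noetherian _) (fun v hv => ?_) (maximalIdeal_le_jacobson _)
    rw [heq] at hv
    obtain ⟨u, rfl⟩ := hv
    rw [LinearMap.lsmul_apply, pow_succ', mul_smul]
    exact Submodule.smul_mem_smul hx ⟨u, rfl⟩
  refine ⟨n, fun v => ?_⟩
  have : x ^ n • v ∈ LinearMap.range (LinearMap.lsmul R N (x ^ n)) := ⟨v, rfl⟩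
  rwa [hbot] at this

lemma exists_pow_smul_mem (hM : FinColength M) {x : R} (hx : x ∈ maximalIdeal R) :
    ∃ n, ∀ v : Fin r → R, x ^ n • v ∈ M := by
  obtain ⟨n, hn⟩ := exists_pow_smul_eq_zero hM hx
  exact ⟨n, fun v => (Submodule.Quotient.mk_eq_zero M).mp (hn (Submodule.Quotient.mk v))⟩

lemma apply_mem_maximalIdeal_of_not_hasFreeSummand (hM : ¬ HasFreeSummand M) :
    ∀ w ∈ M, ∀ i, w i ∈ maximalIdeal R := by
  intro w hw i
  by_contra hwi
  obtain ⟨e, he⟩ := (IsLocalRing.notMem_maximalIdeal.mp hwi).exists_left_inv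
  have hinj : Function.Injective (LinearMap.toSpanSingleton R (Fin r → R) w) := by
    rw [← LinearMap.ker_eq_bot, LinearMap.ker_eq_bot']
    intro a ha
    have := congrFun ha i
    simp only [LinearMap.toSpanSingleton_apply, Pi.smul_apply, smul_eq_mul, Pi.zero_apply] at this
    rw [← mul_one a, ← he, mul_left_comm, this, mul_zero]
  refine hM ⟨LinearMap.range (LinearMap.toSpanSingleton R (Fin r → R) w),
    M ⊓ LinearMap.ker (LinearMap.proj i), le_antisymm (sup_le ?_ inf_le_left) ?_, ?_, ?_, ?_⟩
  · rintro _ ⟨a, rfl⟩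
    exact M.smul_mem a hw
  · intro v hv
    refine Submodule.mem_sup.mpr ⟨(v i * e) • w, ⟨_, rfl⟩, v - (v i * e) • w,
      ⟨M.sub_mem hv (M.smul_mem _ hw), ?_⟩, by simp⟩
    simp [mul_assoc, he]
  · rw [eq_bot_iff]
    rintro _ ⟨⟨a, rfl⟩, -, ha⟩
    have ha' : a * w i = 0 := ha
    have : a = 0 := by rw [← mul_one a, ← he, mul_left_comm, ha', mul_zero]
    simp [this]
  · intro h
    have hw0 : w ∈ LinearMap.range (LinearMap.toSpanSingleton R (Fin r → R) w) := ⟨1, by simp⟩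
    rw [h, Submodule.mem_bot] at hw0
    simp [hw0] at he
  · exact Module.Free.of_equiv (LinearEquiv.ofInjective _ hinj)

lemma length_add_le_length_quotient_maxMinors (hreg : IsTwoDimRegularLocal R)
    [Infinite (ResidueField R)] (h1 : FinColength M) (h2 : ModIntClosed M)
    (h3 : ¬ HasFreeSummand M) :
    Module.length R ((Fin r → R) ⧸ M) + ((r * (r - 1) / 2 : ℕ) : ℕ∞) ≤
      Module.length R (R ⧸ maxMinors M) := by
  obtain ⟨hN, hdim, x₀, y, hm₀⟩ := hreg
  have hR := isDomain_of_ringKrullDim_eq_two hm₀ hdim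
  have hx₀ : x₀ ≠ 0 := by
    rintro rfl
    have := (quotient_span_singleton_regular (x := y) (y := 0) (by rw [hm₀, Set.pair_comm])
      hdim).2.2
    simp at this
  obtain ⟨c, hc⟩ := exists_contracted h2 hx₀ y
  have hm : maximalIdeal R = Ideal.span {x₀ + c * y, y} := by
    rw [hm₀, Ideal.span_pair_add_mul_right]
  obtain ⟨hD, hP, hy⟩ := quotient_span_singleton_regular hm hdim
  have hx0 : x₀ + c * y ≠ 0 := by
    intro h0
    have := (quotient_span_singleton_regular (x := y) (y := x₀ + c * y)
      (by rw [hm, Set.pair_comm]) hdim).2.2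
    simp [h0] at this
  have hx : Prime (x₀ + c * y) :=
    (Ideal.span_singleton_prime hx0).mp ((Ideal.Quotient.isDomain_iff_prime _).mp hD)
  obtain ⟨n, hn⟩ := exists_pow_smul_mem h1 (x := x₀ + c * y) (hm ▸ Ideal.subset_span (by simp))
  obtain ⟨k, hk⟩ := exists_pow_smul_mem h1 (x := y) (hm ▸ Ideal.subset_span (by simp))
  exact add_choose_le_length_of_contracted hm hx hy k r n M hn hk hc
    (apply_mem_maximalIdeal_of_not_hasFreeSummand h3)

end Final

/-- for an integrally closed module `M` of rank `r` without free direct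
summands and with ideal of minors `I = I(M)`, `λ(R/I) − λ(F/M) ≥ r(r−1)/2`. -/
theorem statement5 (R : Type*) [CommRing R] [IsLocalRing R]
    (hreg : IsTwoDimRegularLocal R) [Infinite (IsLocalRing.ResidueField R)]
    (r : ℕ) (M : Submodule R (Fin r → R))
    (h1 : FinColength M) (h2 : ModIntClosed M) (h3 : ¬ HasFreeSummand M) :
    modLength R ((Fin r → R) ⧸ M) + ((r * (r - 1) / 2 : ℕ) : WithBot ℕ∞) ≤
      modLength R (R ⧸ maxMinors M) := by
  have h := WithBot.coe_le_coe.mpr (length_add_le_length_quotient_maxMinors hreg h1 h2 h3)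
  rw [WithBot.coe_add, Module.coe_length, Module.coe_length] at h
  exact h
end
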